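/- arXiv:2409.06170 — 6 statements merged into one kernel-verified Lean document; each statement's English description precedes it below -/
import Mathlib

section
/- Let B be a locally connected metric space, X a locally compact and locally connected metric space, and V a metric space. Let f_t : V → X (t ∈ B) be a continuous family of open Lipschitz embeddings (i.e. (t,x) ↦ f_t(x) is continuous and each f_t is an open Lipschitz embedding). Let C be a closed subset of V whose boundary in V is compact, and assume f_t(C) is closed in X for every t ∈ B. If the Lipschitz deformation principle L(V − C) holds, then for each b ∈ B there exist a neighborhood N_b of b in B and a continuous family of Lipschitz isomorphisms F_t : X → X (t ∈ N_b) such that F_t ∘ f_b = f_t on a neighborhood of C. Moreover, if C is compact, the F_t can be chosen so that in addition F_t ∘ f_b = f_b outside a compact neighborhood of C. -/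
open Topology Metric Set

universe u v w

section Defs

variable {X Y : Type*}

/-- A (local) Lipschitz embedding: `f` is injective, locally Lipschitz, and its inverse
`f ⁻¹ : f(X) → X` is locally Lipschitz. -/
def IsLipschitzEmbedding [MetricSpace X] [MetricSpace Y] (f : X → Y) : Prop :=
  Function.Injective f ∧ LocallyLipschitz f ∧
    ∃ g : Set.range f → X, Function.LeftInverse g (Set.rangeFactorization f) ∧ LocallyLipschitz g

/-- An open Lipschitz embedding: a Lipschitz embedding with open image. -/
def IsOpenLipschitzEmbedding [MetricSpace X] [MetricSpace Y] (f : X → Y) : Prop :=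
  IsLipschitzEmbedding f ∧ IsOpen (Set.range f)

/-- A Lipschitz isomorphism: a surjective Lipschitz embedding. -/
def IsLipschitzIso [MetricSpace X] [MetricSpace Y] (f : X → Y) : Prop :=
  IsLipschitzEmbedding f ∧ Function.Surjective f

/-- The inclusion of a subset, as a continuous map. -/
def inclCM [TopologicalSpace X] (U : Set X) : C(↥U, X) :=
  ⟨Subtype.val, continuous_subtype_val⟩

/-- The data of a deformation rule `h ↦ D h` for the principle `L(X; C; U)`. -/
def DeformationData [MetricSpace X] (U C : Set X) (N : Set C(↥U, X))
    (D : C(↥U, X) → C(X, X)) : Prop :=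
  ContinuousOn D {h | h ∈ N ∧ IsOpenLipschitzEmbedding (⇑h : ↥U → X)} ∧
  D (inclCM U) = ContinuousMap.id X ∧
  ∀ h ∈ N, IsOpenLipschitzEmbedding (⇑h : ↥U → X) →
    IsLipschitzIso (⇑(D h) : X → X) ∧
    (∀ x : ↥U, (x : X) ∈ C → D h x = h x) ∧
    (∀ x : X, x ∉ U → D h x = x)

/-- Sullivan's Lipschitz deformation principle `L(X)`. -/
def LipschitzDeformationPrinciple (X : Type v) [MetricSpace X] : Prop :=
  ∀ U : Set X, IsOpen U → ∀ C : Set X, IsCompact C → C ⊆ U →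
    ∃ N ∈ 𝓝 (inclCM U), ∃ D : C(↥U, X) → C(X, X), DeformationData U C N D

end Defs



def LB {X Y : Type*} [MetricSpace X] [MetricSpace Y] (φ : X → Y) (x : X) : Prop :=
  Filter.map φ (𝓝 x) = 𝓝 (φ x) ∧ ∃ K : ℝ, 0 ≤ K ∧ ∃ s ∈ 𝓝 x, ∀ a ∈ s, ∀ c ∈ s,
    dist (φ a) (φ c) ≤ K * dist a c ∧ dist a c ≤ K * dist (φ a) (φ c)

section LBlemmas
open Filter
variable {X Y Z : Type*} [MetricSpace X] [MetricSpace Y] [MetricSpace Z]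

theorem LB.continuousAt {φ : X → Y} {x : X} (h : LB φ x) : ContinuousAt φ x := h.1.le

theorem LB.comp {ψ : Y → Z} {φ : X → Y} {x : X} (h2 : LB ψ (φ x)) (h1 : LB φ x) :
    LB (fun x => ψ (φ x)) x := by
  have hc := h1.continuousAt
  obtain ⟨m1, K1, k1, s1, hs1, H1⟩ := h1
  obtain ⟨m2, K2, k2, s2, hs2, H2⟩ := h2
  refine ⟨?_, K1 * K2, by positivity, s1 ∩ φ ⁻¹' s2, inter_mem hs1 (hc hs2), ?_⟩
  · rw [← m2, ← m1, Filter.map_map]; rfl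
  · rintro a ⟨ha, ha'⟩ c ⟨hc, hc'⟩
    have e1 := H1 a ha c hc
    have e2 := H2 _ ha' _ hc'
    constructor
    · calc _ ≤ _ := e2.1
        _ ≤ K2 * (K1 * dist a c) := by gcongr; exact e1.1
        _ = _ := by ring
    · calc _ ≤ _ := e1.2
        _ ≤ K1 * (K2 * dist (ψ (φ a)) (ψ (φ c))) := by gcongr; exact e2.2
        _ = _ := by ring

theorem LB.congr {ψ φ : X → Y} {x : X} (h : LB φ x) (e : ψ =ᶠ[𝓝 x] φ) : LB ψ x := by
  obtain ⟨m1, K1, k1, s1, hs1, H1⟩ := h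
  refine ⟨?_, K1, k1, s1 ∩ {y | ψ y = φ y}, inter_mem hs1 e, ?_⟩
  · rw [Filter.map_congr e, m1, e.eq_of_nhds]
  · rintro a ⟨ha, ha'⟩ c ⟨hc, hc'⟩
    change ψ a = φ a at ha'
    change ψ c = φ c at hc'
    rw [ha', hc']; exact H1 a ha c hc

theorem LB.id (x : X) : LB (fun x : X => x) x :=
  ⟨Filter.map_id, 1, zero_le_one, univ, univ_mem, by simp⟩

theorem LB.val {s : Set X} (hs : IsOpen s) (x : s) : LB (Subtype.val : s → X) x :=
  ⟨hs.isOpenEmbedding_subtypeVal.map_nhds_eq x, 1, zero_le_one, univ, univ_mem, by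
    simp [Subtype.dist_eq]⟩

theorem LB.cod {s : Set Y} (hs : IsOpen s) {φ : X → s} {x : X}
    (h : LB (fun x => (φ x : Y)) x) : LB φ x := by
  obtain ⟨m1, K1, k1, s1, hs1, H1⟩ := h
  refine ⟨?_, K1, k1, s1, hs1, H1⟩
  apply Filter.map_injective (Subtype.val_injective (p := fun y => y ∈ s))
  rw [hs.isOpenEmbedding_subtypeVal.map_nhds_eq, ← m1, Filter.map_map]; rfl

theorem LB.inv {φ : X → Y} {g : Y → X} {x : X} (h : LB φ x) (e : ∀ x, g (φ x) = x) :
    LB g (φ x) := by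
  obtain ⟨m1, K1, k1, s1, hs1, H1⟩ := h
  refine ⟨?_, K1, k1, φ '' s1, ?_, ?_⟩
  · rw [← m1, Filter.map_map, e]
    have : g ∘ φ = fun x => x := funext e
    rw [this]; exact Filter.map_id
  · rw [← m1]; exact image_mem_map hs1
  · rintro _ ⟨a, ha, rfl⟩ _ ⟨c, hc, rfl⟩
    rw [e, e]; exact (H1 a ha c hc).symm

theorem LB.locLip {φ : X → Y} {x : X} (h : LB φ x) :
    ∃ K, ∃ t ∈ 𝓝 x, LipschitzOnWith K φ t := by
  obtain ⟨m1, K1, k1, s1, hs1, H1⟩ := h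
  exact ⟨⟨K1, k1⟩, s1, hs1, LipschitzOnWith.of_dist_le_mul fun a ha c hc => (H1 a ha c hc).1⟩

theorem isOpenMap_of_LB {φ : X → Y} (h : ∀ x, LB φ x) : IsOpenMap φ :=
  IsOpenMap.of_nhds_le fun x => (h x).1.ge

theorem openEmb_of_LB {φ : X → Y} (hi : Function.Injective φ) (h : ∀ x, LB φ x) :
    IsOpenLipschitzEmbedding φ := by
  refine ⟨⟨hi, fun x => (h x).locLip, fun y => y.2.choose, ?_, ?_⟩,
    (isOpenMap_of_LB h).isOpen_range⟩
  · intro x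
    exact hi (Exists.choose_spec (⟨x, rfl⟩ : ∃ a, φ a = φ x))
  · rintro ⟨y, x, rfl⟩
    have hg : ∀ z : range φ, φ (z.2.choose) = z := fun z => z.2.choose_spec
    obtain ⟨m1, K1, k1, s1, hs1, H1⟩ := h x
    refine ⟨⟨K1, k1⟩, Subtype.val ⁻¹' (φ '' s1), ?_, ?_⟩
    · apply continuous_subtype_val.continuousAt
      change φ '' s1 ∈ 𝓝 (φ x)
      rw [← m1]; exact image_mem_map hs1
    · apply LipschitzOnWith.of_dist_le_mul
      rintro a ⟨a', ha, ha'⟩ c ⟨c', hc, hc'⟩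
      have e1 : a.2.choose = a' := hi ((hg a).trans ha'.symm)
      have e2 : c.2.choose = c' := hi ((hg c).trans hc'.symm)
      rw [e1, e2, Subtype.dist_eq, ← ha', ← hc']
      exact (H1 a' ha c' hc).2

theorem iso_of_LB {φ : X → Y} (hi : Function.Bijective φ) (h : ∀ x, LB φ x) :
    IsLipschitzIso φ := ⟨(openEmb_of_LB hi.1 h).1, hi.2⟩

theorem LB_of_openEmb {φ : X → Y} (h : IsOpenLipschitzEmbedding φ) (x : X) : LB φ x := by
  obtain ⟨⟨hi, hl, g, hg, hgl⟩, ho⟩ := h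
  have hoe : IsOpenEmbedding φ := by
    let H : X ≃ₜ range φ :=
      { toFun := rangeFactorization φ
        invFun := g
        left_inv := hg
        right_inv := by
          rintro ⟨_, x, rfl⟩
          exact congrArg (rangeFactorization φ) (hg x)
        continuous_toFun := hl.continuous.subtype_mk _
        continuous_invFun := hgl.continuous }
    exact ho.isOpenEmbedding_subtypeVal.comp H.isOpenEmbedding
  obtain ⟨K1, t1, ht1, H1⟩ := hl x
  obtain ⟨K2, t2, ht2, H2⟩ := hgl (rangeFactorization φ x)
  refine ⟨hoe.map_nhds_eq x, K1 + K2, by positivity, t1 ∩ rangeFactorization φ ⁻¹' t2,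
    inter_mem ht1 ?_, ?_⟩
  · exact (hl.continuous.subtype_mk (p := fun y => y ∈ range φ)
      (fun x => ⟨x, rfl⟩)).continuousAt ht2
  · rintro a ⟨ha, ha'⟩ c ⟨hc, hc'⟩
    have e1 := H1.dist_le_mul a ha c hc
    have e2 := H2.dist_le_mul _ ha' _ hc'
    rw [hg, hg, Subtype.dist_eq] at e2
    change _ ≤ _ * dist (φ a) (φ c) at e2
    constructor
    · refine e1.trans ?_
      gcongr; simp
    · refine e2.trans ?_
      gcongr; simp

theorem LB_of_iso {φ : X → Y} (h : IsLipschitzIso φ) (x : X) : LB φ x :=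
  LB_of_openEmb ⟨h.1, by rw [h.2.range_eq]; exact isOpen_univ⟩ x

theorem nhds_of_LB {φ : X → Y} (h : ∀ x, LB φ x) {W : Set X} (hW : IsClosed (φ '' W)) {y : Y}
    (hy : y ∉ φ '' frontier W) : ∀ᶠ z in 𝓝 y, (z ∈ φ '' W ↔ y ∈ φ '' W) := by
  by_cases hyW : y ∈ φ '' W
  · obtain ⟨x, hx, rfl⟩ := hyW
    have hxi : x ∈ interior W := by
      by_contra hn
      exact hy ⟨x, ⟨subset_closure hx, hn⟩, rfl⟩
    have : φ '' W ∈ 𝓝 (φ x) := by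
      rw [← (h x).1]; exact image_mem_map (mem_interior_iff_mem_nhds.1 hxi)
    filter_upwards [this] with z hz
    exact ⟨fun _ => ⟨x, hx, rfl⟩, fun _ => hz⟩
  · filter_upwards [hW.isOpen_compl.mem_nhds hyW] with z hz
    exact ⟨fun h => (hz h).elim, fun h => (hyW h).elim⟩

end LBlemmas

section Main
open Filter

theorem stage_one
    {B : Type u} {X : Type v} {V : Type w}
    [MetricSpace B] [LocallyConnectedSpace B]
    [MetricSpace X] [MetricSpace V] [LocallyCompactSpace V]
    (f : B → V → X)
    (hcont : Continuous fun q : B × V => f q.1 q.2)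
    (hemb : ∀ t, IsOpenLipschitzEmbedding (f t))
    (C : Set V) (hC : IsClosed C)
    (hL : LipschitzDeformationPrinciple ↥(Cᶜ)) (b : B)
    (g : X → V) (hg : ∀ x, g (f b x) = x)
    (A K : Set V) (hA : IsCompact A) (hK : IsCompact K) (hAK : A ⊆ interior K) (hKC : K ⊆ Cᶜ) :
    ∃ N ∈ 𝓝 b, IsPreconnected N ∧ ∃ E : ↥N → V → V,
      Continuous (fun q : ↥N × V => E q.1 q.2) ∧
      (∀ t, Function.Bijective (E t)) ∧ (∀ t x, LB (E t) x) ∧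
      (∀ t, ∀ x ∉ K, E t x = x) ∧ (∀ t : ↥N, ∀ x ∈ A, f b (E t x) = f t x) ∧
      (∀ t : ↥N, (t : B) = b → ∀ x, E t x = x) := by
  classical
  have hO : IsOpen Cᶜ := hC.isOpen_compl
  have hlb : ∀ t x, LB (f t) x := fun t => LB_of_openEmb (hemb t)
  have hglb : ∀ x, LB g (f b x) := fun x => (hlb b x).inv hg
  set U : Set ↥(Cᶜ) := Subtype.val ⁻¹' (interior K) with hU
  have hUo : IsOpen U := isOpen_interior.preimage continuous_subtype_val
  set A' : Set ↥(Cᶜ) := Subtype.val ⁻¹' A with hA'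
  have hA'c : IsCompact A' := by
    rw [Topology.IsInducing.subtypeVal.isCompact_iff, hA', Subtype.image_preimage_coe,
      inter_eq_right.2]
    · exact hA
    · exact hAK.trans (interior_subset.trans hKC)
  obtain ⟨M, hM, D, hDc, hDi, hD⟩ := hL U hUo A' hA'c (preimage_mono hAK)
  have hfO : IsOpen (f b '' Cᶜ) := isOpenMap_of_LB (hlb b) _ hO
  have hN1 : ∀ᶠ t in 𝓝 b, ∀ x ∈ K, f t x ∈ f b '' Cᶜ := by
    apply hK.eventually_forall_of_forall_eventually
    intro x hx
    exact hcont.continuousAt (hfO.mem_nhds ⟨x, hKC hx, rfl⟩)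
  -- the family h
  let N1 : Set B := {t | ∀ x ∈ K, f t x ∈ f b '' Cᶜ}
  have hgC : ∀ (t : N1) (u : U), g (f t u.1.1) ∈ Cᶜ := by
    intro t u
    obtain ⟨z, hz, hz'⟩ := t.2 _ (interior_subset u.2)
    rw [← hz', hg]; exact hz
  have hfg : ∀ (t : N1) (u : U), f b (g (f t u.1.1)) = f t u.1.1 := by
    intro t u
    obtain ⟨z, hz, hz'⟩ := t.2 _ (interior_subset u.2)
    rw [← hz', hg]
  have hglb' : ∀ (t : N1) (u : U), LB g (f t u.1.1) := by
    intro t u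
    rw [← hfg]; exact hglb _
  have hHc : Continuous (fun q : N1 × U => (⟨g (f q.1 q.2.1.1), hgC q.1 q.2⟩ : ↥(Cᶜ))) := by
    apply Continuous.subtype_mk
    rw [continuous_iff_continuousAt]
    intro q
    have h1 : ContinuousAt (fun q : N1 × U => f q.1 q.2.1.1) q :=
      (hcont.comp (f := fun q : N1 × U => ((q.1 : B), q.2.1.1)) (by fun_prop)).continuousAt
    exact ContinuousAt.comp (f := fun q : N1 × U => f q.1 q.2.1.1)
      (hglb' q.1 q.2).continuousAt h1
  let h : C(N1, C(U, ↥(Cᶜ))) := ContinuousMap.curry ⟨_, hHc⟩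
  have hval : ∀ t u, ((h t u : ↥(Cᶜ)) : V) = g (f t u.1.1) := fun t u => rfl
  have hb1 : b ∈ N1 := hN1.self_of_nhds
  have hhb : h ⟨b, hb1⟩ = inclCM U := by
    ext u
    rw [hval]; exact hg _
  have hhemb : ∀ t, IsOpenLipschitzEmbedding (⇑(h t) : U → ↥(Cᶜ)) := by
    intro t
    apply openEmb_of_LB
    · intro u u' huu
      have := congrArg (fun z : ↥(Cᶜ) => f b z) huu
      simp only [hval, hfg] at this
      exact Subtype.ext (Subtype.ext ((hemb t).1.1 this))
    · intro u
      apply LB.cod hO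
      have e1 : LB (fun u : U => f t u.1.1) u :=
        LB.comp (ψ := f t) (φ := fun u : U => u.1.1) (hlb t u.1.1)
          ((LB.val hO u.1).comp (LB.val hUo u))
      exact LB.comp (ψ := g) (φ := fun u : U => f t u.1.1) (hglb' t u) e1
  have hS : h ⁻¹' M ∈ 𝓝 (⟨b, hb1⟩ : N1) := by
    apply h.continuous.continuousAt
    rw [hhb]; exact hM
  have hS' : Subtype.val '' (h ⁻¹' M) ∈ 𝓝 b := by
    have := image_mem_map (m := (Subtype.val : N1 → B)) hS
    rwa [map_nhds_subtype_coe_eq_nhds hb1 hN1] at this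
  obtain ⟨N, hN, hNp, hNS⟩ := locallyConnectedSpace_iff_connected_subsets.1 inferInstance b _ hS'
  have hNN1 : ∀ t : N, (t : B) ∈ N1 := fun t => by
    obtain ⟨z, _, hz⟩ := hNS t.2
    rw [← hz]; exact z.2
  let j : N → N1 := fun t => ⟨t, hNN1 t⟩
  have hj : Continuous j := by fun_prop
  have hjM : ∀ t, h (j t) ∈ M := fun t => by
    obtain ⟨z, hz, hz'⟩ := hNS t.2
    have : j t = z := Subtype.ext hz'.symm
    rw [this]; exact hz
  have hDcont : Continuous (fun t : N => D (h (j t))) :=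
    hDc.comp_continuous (h.continuous.comp hj) fun t => ⟨hjM t, hhemb _⟩
  have : LocallyCompactSpace ↥(Cᶜ) := hO.locallyCompactSpace
  have hDev : Continuous (fun q : N × ↥(Cᶜ) => D (h (j q.1)) q.2) :=
    (hDcont.comp continuous_fst).eval continuous_snd
  let E : N → V → V := fun t x => if hx : x ∈ Cᶜ then (D (h (j t)) ⟨x, hx⟩ : ↥(Cᶜ)) else x
  have hE1 : ∀ t (x : ↥(Cᶜ)), E t x = D (h (j t)) x := fun t x => dif_pos x.2
  have hE2 : ∀ t, ∀ x ∉ K, E t x = x := by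
    intro t x hx
    by_cases hxC : x ∈ Cᶜ
    · rw [hE1 t ⟨x, hxC⟩, (hD _ (hjM t) (hhemb _)).2.2]
      exact fun h => hx (interior_subset h)
    · exact dif_neg hxC
  have hE3 : ∀ t, ∀ x ∈ C, E t x = x := fun t x hx => dif_neg (by simpa using hx)
  have hKcl : IsOpen Kᶜ := hK.isClosed.isOpen_compl
  refine ⟨N, hN, hNp, E, ?_, ?_, ?_, hE2, ?_, ?_⟩
  · rw [continuous_iff_continuousAt]
    rintro ⟨t, x⟩
    by_cases hx : x ∈ Cᶜ
    · have hoe : IsOpenEmbedding (Prod.map id Subtype.val : N × ↥(Cᶜ) → N × V) :=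
        IsOpenEmbedding.id.prodMap hO.isOpenEmbedding_subtypeVal
      have : ContinuousAt (fun q : N × V => E q.1 q.2)
          ((Prod.map id Subtype.val : N × ↥(Cᶜ) → N × V) (t, ⟨x, hx⟩)) := by
        rw [← hoe.continuousAt_iff]
        have : ((fun q : N × V => E q.1 q.2) ∘ (Prod.map id Subtype.val : N × ↥(Cᶜ) → N × V)) =
            fun q => ((D (h (j q.1)) q.2 : ↥(Cᶜ)) : V) := by
          ext q; exact hE1 _ _
        rw [this]
        exact (continuous_subtype_val.comp hDev).continuousAt
      exact this
    · have hx' : x ∈ Kᶜ := fun h => hx (hKC h)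
      have : ContinuousAt (fun q : N × V => q.2) (t, x) := continuous_snd.continuousAt
      refine this.congr ?_
      filter_upwards [continuous_snd.continuousAt.preimage_mem_nhds (hKcl.mem_nhds hx')]
        with q hq
      exact (hE2 _ _ hq).symm
  · intro t
    obtain ⟨⟨hi, -⟩, hs⟩ := (hD _ (hjM t) (hhemb _)).1
    constructor
    · intro x y hxy
      by_cases hx : x ∈ Cᶜ <;> by_cases hy : y ∈ Cᶜ
      · rw [hE1 t ⟨x, hx⟩, hE1 t ⟨y, hy⟩] at hxy
        exact congrArg Subtype.val (hi (Subtype.ext hxy))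
      · rw [hE1 t ⟨x, hx⟩, hE3 t y (not_not.1 hy)] at hxy
        exact (hy (hxy ▸ Subtype.property _)).elim
      · rw [hE1 t ⟨y, hy⟩, hE3 t x (not_not.1 hx)] at hxy
        exact (hx (hxy ▸ Subtype.property _)).elim
      · rwa [hE3 t y (not_not.1 hy), hE3 t x (not_not.1 hx)] at hxy
    · intro y
      by_cases hy : y ∈ Cᶜ
      · obtain ⟨x, hx⟩ := hs ⟨y, hy⟩
        exact ⟨x, by rw [hE1, hx]⟩
      · exact ⟨y, hE3 t y (not_not.1 hy)⟩
  · intro t x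
    by_cases hx : x ∈ Cᶜ
    · have e1 : LB (fun x : ↥(Cᶜ) => (D (h (j t)) x : V)) ⟨x, hx⟩ :=
        (LB.val hO _).comp (LB_of_iso (hD _ (hjM t) (hhemb _)).1 _)
      have hr : ∃ r : V → ↥(Cᶜ), ∀ z : ↥(Cᶜ), r z = z :=
        ⟨fun z => if hz : z ∈ Cᶜ then ⟨z, hz⟩ else ⟨x, hx⟩, fun z => dif_pos z.2⟩
      obtain ⟨r, hr⟩ := hr
      have e2 : LB r x := (LB.val hO ⟨x, hx⟩).inv hr
      have e3 : LB (fun x : ↥(Cᶜ) => (D (h (j t)) x : V)) (r x) := by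
        rw [hr ⟨x, hx⟩]; exact e1
      refine (e3.comp e2).congr ?_
      filter_upwards [hO.mem_nhds hx] with z hz
      rw [hr ⟨z, hz⟩]
      exact hE1 t ⟨z, hz⟩
    · have hx' : x ∈ Kᶜ := fun h => hx (hKC h)
      refine (LB.id x).congr ?_
      filter_upwards [hKcl.mem_nhds hx'] with z hz
      exact hE2 t z hz
  · intro t x hx
    have hxC : x ∈ Cᶜ := hKC (interior_subset (hAK hx))
    rw [hE1 t ⟨x, hxC⟩]
    have := (hD _ (hjM t) (hhemb _)).2.1 ⟨⟨x, hxC⟩, hAK hx⟩ hx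
    rw [this, hval, hfg]
  · intro t ht x
    by_cases hx : x ∈ Cᶜ
    · rw [hE1 t ⟨x, hx⟩]
      have : j t = ⟨b, hb1⟩ := Subtype.ext ht
      rw [this, hhb, hDi]; rfl
    · exact hE3 t x (not_not.1 hx)

theorem clopen_path {N X : Type*} [TopologicalSpace N] [PreconnectedSpace N] [TopologicalSpace X]
    {S : Set X} (hS : IsClopen S) {γ : N → X} (hγ : Continuous γ) {s t : N} (h : γ s ∈ S) :
    γ t ∈ S := by
  have := (hS.preimage hγ).eq_univ ⟨s, h⟩
  exact (this ▸ mem_univ t : t ∈ γ ⁻¹' S)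

theorem isClopen_of_loc {X : Type*} [TopologicalSpace X] {S : Set X}
    (h : ∀ y, ∀ᶠ z in 𝓝 y, (z ∈ S ↔ y ∈ S)) : IsClopen S := by
  constructor
  · rw [← isOpen_compl_iff, isOpen_iff_eventually]
    intro y hy
    filter_upwards [h y] with z hz using fun h' => hy (hz.1 h')
  · rw [isOpen_iff_eventually]
    intro y hy
    filter_upwards [h y] with z hz using hz.2 hy

theorem isClopen_diff {X : Type*} [TopologicalSpace X] {P Q : Set X}
    (h : ∀ y, (∀ᶠ z in 𝓝 y, (z ∈ P ↔ z ∈ Q)) ∨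
      ((∀ᶠ z in 𝓝 y, (z ∈ P ↔ y ∈ P)) ∧ ∀ᶠ z in 𝓝 y, (z ∈ Q ↔ y ∈ Q))) :
    IsClopen (P \ Q) := by
  apply isClopen_of_loc
  intro y
  rcases h y with h | ⟨h1, h2⟩
  · have := h.self_of_nhds
    filter_upwards [h] with z hz
    simp only [Set.mem_sdiff]; tauto
  · filter_upwards [h1, h2] with z hz hz'
    simp only [Set.mem_sdiff]; tauto

theorem stage_two
    {B : Type u} {X : Type v} {V : Type w}
    [MetricSpace B] [LocallyConnectedSpace B]
    [MetricSpace X] [LocallyCompactSpace X]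
    [MetricSpace V]
    (f : B → V → X)
    (hcont : Continuous fun q : B × V => f q.1 q.2)
    (hemb : ∀ t, IsOpenLipschitzEmbedding (f t))
    (C : Set V) (hC : IsClosed C) (hbd : IsCompact (frontier C))
    (hCcl : ∀ t, IsClosed (f t '' C))
    (hL : LipschitzDeformationPrinciple ↥(Cᶜ)) (b : B) :
    ∃ N ∈ 𝓝 b, ∃ F : ↥N → X → X,
        Continuous (fun q : ↥N × X => F q.1 q.2) ∧
        (∀ t, IsLipschitzIso (F t)) ∧
        (∃ W, IsOpen W ∧ C ⊆ W ∧ ∀ t : ↥N, ∀ x ∈ W, F t (f b x) = f (t : B) x) ∧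
        (IsCompact C → ∃ K : Set V, IsCompact K ∧ C ⊆ interior K ∧
            ∀ t : ↥N, ∀ x ∉ K, F t (f b x) = f b x) := by
  classical
  have hO : IsOpen Cᶜ := hC.isOpen_compl
  have hlb : ∀ t x, LB (f t) x := fun t => LB_of_openEmb (hemb t)
  have hinj : ∀ t, Function.Injective (f t) := fun t => (hemb t).1.1
  have hfc : ∀ t, Continuous (f t) := fun t =>
    continuous_iff_continuousAt.2 fun x => (hlb t x).continuousAt
  have hfo : ∀ t, IsOpenMap (f t) := fun t => isOpenMap_of_LB (hlb t)
  have hVlc : LocallyCompactSpace V :=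
    (IsOpenEmbedding.of_continuous_injective_isOpenMap (hfc b) (hinj b) (hfo b)).locallyCompactSpace
  rcases isEmpty_or_nonempty V with hVe | hVn
  · exact ⟨univ, univ_mem, fun _ x => x, continuous_snd,
      fun _ => iso_of_LB Function.bijective_id LB.id,
      ⟨univ, isOpen_univ, subset_univ _, fun _ x => hVe.elim x⟩,
      fun _ => ⟨∅, isCompact_empty, fun x => hVe.elim x, fun _ x => hVe.elim x⟩⟩
  have hgex : ∃ g : X → V, ∀ x, g (f b x) = x :=
    ⟨Function.invFun (f b), Function.leftInverse_invFun (hinj b)⟩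
  obtain ⟨g, hg⟩ := hgex
  have hglb : ∀ x, LB g (f b x) := fun x => (hlb b x).inv hg
  -- the sets
  obtain ⟨K1, hK1, hK1i, -⟩ := exists_compact_between hbd isOpen_univ (subset_univ _)
  set W := C ∪ K1 with hWdef
  have hWcl : IsClosed W := hC.union hK1.isClosed
  have hCW : C ⊆ interior W := by
    intro x hx
    by_cases hxi : x ∈ interior C
    · exact interior_mono subset_union_left hxi
    · exact interior_mono subset_union_right (hK1i ⟨subset_closure hx, hxi⟩)
  have hA0 : IsCompact (frontier W) := by
    refine (hbd.union hK1).of_isClosed_subset isClosed_frontier ?_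
    refine (frontier_union_subset _ _).trans ?_
    refine union_subset_union inter_subset_left (inter_subset_right.trans ?_)
    exact hK1.isClosed.frontier_subset
  have hA0C : frontier W ⊆ Cᶜ := fun x hx hxC => hx.2 (hCW hxC)
  obtain ⟨K, hK, hAK0, hKC⟩ := exists_compact_between hA0 hO hA0C
  obtain ⟨A, hA, hA0A, hAK⟩ := exists_compact_between hA0 isOpen_interior hAK0
  obtain ⟨N, hN, hNp, E, hEc, hEbij, hElb, hEK, hEA, hEb⟩ :=
    stage_one f hcont hemb C hC hL b g hg A K hA hK hAK hKC
  have hNps : PreconnectedSpace N := Subtype.preconnectedSpace hNp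
  let b' : N := ⟨b, mem_of_mem_nhds hN⟩
  -- the extension `G` of `E` to `X`
  let G : N → X → X := fun t y => if y ∈ range (f b) then f b (E t (g y)) else y
  have hG1 : ∀ t x, G t (f b x) = f b (E t x) := by
    intro t x
    simp only [G, if_pos (mem_range_self x), hg]
  have hG2 : ∀ t, ∀ y ∉ range (f b), G t y = y := fun t y hy => if_neg hy
  have hGK : ∀ t, ∀ y ∉ f b '' K, G t y = y := by
    intro t y hy
    by_cases hyr : y ∈ range (f b)
    · obtain ⟨x, rfl⟩ := hyr
      rw [hG1, hEK]
      exact fun hx => hy ⟨x, hx, rfl⟩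
    · exact hG2 t y hyr
  have hRo : IsOpen (range (f b)) := (hemb b).2
  have hKo : IsOpen (f b '' K)ᶜ := (hK.image (hfc b)).isClosed.isOpen_compl
  have hGbij : ∀ t, Function.Bijective (G t) := by
    intro t
    constructor
    · intro x y hxy
      by_cases hx : x ∈ range (f b) <;> by_cases hy : y ∈ range (f b)
      · obtain ⟨x, rfl⟩ := hx
        obtain ⟨y, rfl⟩ := hy
        rw [hG1, hG1] at hxy
        rw [(hEbij t).1 (hinj b hxy)]
      · obtain ⟨x, rfl⟩ := hx
        rw [hG1, hG2 t y hy] at hxy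
        exact (hy ⟨_, hxy⟩).elim
      · obtain ⟨y, rfl⟩ := hy
        rw [hG1, hG2 t x hx] at hxy
        exact (hx ⟨_, hxy.symm⟩).elim
      · rwa [hG2 t y hy, hG2 t x hx] at hxy
    · intro y
      by_cases hy : y ∈ range (f b)
      · obtain ⟨y, rfl⟩ := hy
        obtain ⟨x, rfl⟩ := (hEbij t).2 y
        exact ⟨f b x, hG1 t x⟩
      · exact ⟨y, hG2 t y hy⟩
  have hGlb : ∀ t y, LB (G t) y := by
    intro t y
    by_cases hy : y ∈ range (f b)
    · have e1 : LB (fun y => E t (g y)) y := by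
        obtain ⟨x, rfl⟩ := hy
        exact LB.comp (ψ := E t) (hElb t _) (hglb x)
      refine (LB.comp (ψ := f b) (φ := fun y => E t (g y)) (hlb b _) e1).congr ?_
      filter_upwards [hRo.mem_nhds hy] with z hz
      exact if_pos hz
    · have hy' : y ∈ (f b '' K)ᶜ := fun h => hy (image_subset_range _ _ h)
      refine (LB.id y).congr ?_
      filter_upwards [hKo.mem_nhds hy'] with z hz
      exact hGK t z hz
  have hGc : Continuous (fun q : N × X => G q.1 q.2) := by
    rw [continuous_iff_continuousAt]
    rintro ⟨t, y⟩
    by_cases hy : y ∈ range (f b)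
    · have hgy : ContinuousAt g y := by
        obtain ⟨x, rfl⟩ := hy
        exact (hglb x).continuousAt
      have e0 : ContinuousAt (fun q : N × X => (q.1, g q.2)) (t, y) :=
        continuousAt_fst.prodMk
          (ContinuousAt.comp (f := fun q : N × X => q.2) hgy continuousAt_snd)
      have e1 : ContinuousAt (fun q : N × X => f b (E q.1 (g q.2))) (t, y) :=
        ContinuousAt.comp (g := fun q : N × V => f b (E q.1 q.2))
          ((hfc b).comp hEc).continuousAt e0
      refine e1.congr ?_
      filter_upwards [continuous_snd.continuousAt.preimage_mem_nhds (hRo.mem_nhds hy)]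
        with q hq
      exact (if_pos hq).symm
    · have hy' : y ∈ (f b '' K)ᶜ := fun h => hy (image_subset_range _ _ h)
      have : ContinuousAt (fun q : N × X => q.2) (t, y) := continuous_snd.continuousAt
      refine this.congr ?_
      filter_upwards [continuous_snd.continuousAt.preimage_mem_nhds (hKo.mem_nhds hy')]
        with q hq
      exact (hGK _ _ hq).symm
  have hGA : ∀ t : N, ∀ x ∈ A, G t (f b x) = f t x := fun t x hx => by rw [hG1, hEA t x hx]
  have hGb : ∀ x, G b' (f b x) = f b x := fun x => by rw [hG1, hEb b' rfl]
  -- the images of `W` agree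
  have hWim : ∀ t, IsClosed (f t '' W) := by
    intro t
    rw [hWdef, image_union]
    exact (hCcl t).union (hK1.image (hfc t)).isClosed
  have hPQ : ∀ t : N, (fun x => G t (f b x)) '' W = f t '' W := by
    intro t
    have hGf : ∀ x, LB (fun x => G t (f b x)) x := fun x => (hGlb t _).comp (hlb b x)
    have hGfi : Function.Injective (fun x => G t (f b x)) := (hGbij t).1.comp (hinj b)
    have hPcl : IsClosed ((fun x => G t (f b x)) '' W) := by
      have e : (fun x => G t (f b x)) '' W = G t '' (f b '' W) := by rw [image_image]
      rw [e, ← isOpen_compl_iff, ← image_compl_eq (hGbij t)]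
      exact isOpenMap_of_LB (hGlb t) _ (hWim b).isOpen_compl
    have key : ∀ y, (∀ᶠ z in 𝓝 y, (z ∈ (fun x => G t (f b x)) '' W ↔ z ∈ f t '' W)) ∨
      ((∀ᶠ z in 𝓝 y, (z ∈ (fun x => G t (f b x)) '' W ↔ y ∈ (fun x => G t (f b x)) '' W)) ∧
        ∀ᶠ z in 𝓝 y, (z ∈ f t '' W ↔ y ∈ f t '' W)) := by
      intro y
      by_cases hy : y ∈ f t '' frontier W
      · left
        obtain ⟨a, ha, rfl⟩ := hy
        rw [← (hlb t a).1, Filter.eventually_map]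
        filter_upwards [mem_interior_iff_mem_nhds.1 (hA0A ha)] with x hx
        rw [(hinj t).mem_set_image, ← hGA t x hx]
        exact hGfi.mem_set_image
      · right
        refine ⟨nhds_of_LB hGf hPcl ?_, nhds_of_LB (hlb t) (hWim t) hy⟩
        rintro ⟨a, ha, rfl⟩
        exact hy ⟨a, ha, (hGA t a (interior_subset (hA0A ha))).symm⟩
    have key' : ∀ y, (∀ᶠ z in 𝓝 y, (z ∈ f t '' W ↔ z ∈ (fun x => G t (f b x)) '' W)) ∨
      ((∀ᶠ z in 𝓝 y, (z ∈ f t '' W ↔ y ∈ f t '' W)) ∧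
      (∀ᶠ z in 𝓝 y, (z ∈ (fun x => G t (f b x)) '' W ↔ y ∈ (fun x => G t (f b x)) '' W))) := by
      intro y
      rcases key y with h | ⟨h1, h2⟩
      · left; filter_upwards [h] with z hz using hz.symm
      · exact Or.inr ⟨h2, h1⟩
    have c1 := isClopen_diff key
    have c2 := isClopen_diff key'
    have p1 : ∀ x, Continuous (fun s : N => G s (f b x)) := fun x =>
      hGc.comp (continuous_id.prodMk continuous_const)
    have p2 : ∀ x, Continuous (fun s : N => f s x) := fun x =>
      hcont.comp (continuous_subtype_val.prodMk continuous_const)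
    apply Subset.antisymm
    · rintro _ ⟨x, hx, rfl⟩
      by_contra hn
      have q1 := clopen_path c1 (p1 x) (s := t) (t := b') ⟨⟨x, hx, rfl⟩, hn⟩
      simp only [hGb] at q1
      have q2 := clopen_path c1 (p2 x) (s := b') (t := t) q1
      exact q2.2 ⟨x, hx, rfl⟩
    · rintro _ ⟨x, hx, rfl⟩
      by_contra hn
      have q1 := clopen_path c2 (p2 x) (s := t) (t := b') ⟨⟨x, hx, rfl⟩, hn⟩
      change f b x ∈ _ at q1
      rw [← hGb x] at q1
      have q2 := clopen_path c2 (p1 x) (s := b') (t := t) q1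
      exact q2.2 ⟨x, hx, rfl⟩
  -- the glued map
  let F : N → X → X := fun t y => if y ∈ f b '' W then f t (g y) else G t y
  have hF1 : ∀ t : N, ∀ x ∈ W, F t (f b x) = f t x := by
    intro t x hx
    simp only [F, if_pos (mem_image_of_mem _ hx), hg]
  have hF2 : ∀ t : N, ∀ y ∉ f b '' W, F t y = G t y := fun t y hy => if_neg hy
  have hF3 : ∀ t : N, ∀ x ∈ A, F t (f b x) = f t x := by
    intro t x hx
    by_cases hxW : x ∈ W
    · exact hF1 t x hxW
    · rw [hF2 t _ (by rwa [(hinj b).mem_set_image]), hGA t x hx]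
  let O1 : Set X := f b '' (interior W ∪ interior A)
  have hO1 : IsOpen O1 := hfo b _ (isOpen_interior.union isOpen_interior)
  have hO2 : IsOpen (f b '' W)ᶜ := (hWim b).isOpen_compl
  have hcov : ∀ y ∉ (f b '' W)ᶜ, y ∈ O1 := by
    intro y hy
    obtain ⟨x, hx, rfl⟩ := not_not.1 hy
    refine mem_image_of_mem _ ?_
    by_cases hxi : x ∈ interior W
    · exact Or.inl hxi
    · exact Or.inr (hA0A ⟨subset_closure hx, hxi⟩)
  have hFO1 : ∀ t : N, ∀ y ∈ O1, F t y = f t (g y) := by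
    rintro t _ ⟨x, hx, rfl⟩
    rw [hg]
    rcases hx with hx | hx
    · exact hF1 t x (interior_subset hx)
    · exact hF3 t x (interior_subset hx)
  have hFlb : ∀ t y, LB (F t) y := by
    intro t y
    by_cases hy : y ∈ (f b '' W)ᶜ
    · refine (hGlb t y).congr ?_
      filter_upwards [hO2.mem_nhds hy] with z hz using hF2 t z hz
    · have hy1 := hcov y hy
      have hgy : LB g y := by
        obtain ⟨x, -, rfl⟩ := hy1
        exact hglb x
      refine (LB.comp (ψ := f t) (hlb t _) hgy).congr ?_
      filter_upwards [hO1.mem_nhds hy1] with z hz using hFO1 t z hz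
  have hFc : Continuous (fun q : N × X => F q.1 q.2) := by
    rw [continuous_iff_continuousAt]
    rintro ⟨t, y⟩
    by_cases hy : y ∈ (f b '' W)ᶜ
    · refine hGc.continuousAt.congr ?_
      filter_upwards [continuous_snd.continuousAt.preimage_mem_nhds (hO2.mem_nhds hy)]
        with q hq
      exact (hF2 _ _ hq).symm
    · have hy1 := hcov y hy
      have hgy : ContinuousAt g y := by
        obtain ⟨x, -, rfl⟩ := hy1
        exact (hglb x).continuousAt
      have e0 : ContinuousAt (fun q : N × X => ((q.1 : B), g q.2)) (t, y) :=
        (continuous_subtype_val.comp continuous_fst).continuousAt.prodMk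
          (ContinuousAt.comp (f := fun q : N × X => q.2) hgy continuousAt_snd)
      have e1 : ContinuousAt (fun q : N × X => f q.1 (g q.2)) (t, y) :=
        ContinuousAt.comp (g := fun q : B × V => f q.1 q.2) hcont.continuousAt e0
      refine e1.congr ?_
      filter_upwards [continuous_snd.continuousAt.preimage_mem_nhds (hO1.mem_nhds hy1)]
        with q hq
      exact (hFO1 _ _ hq).symm
  have hFbij : ∀ t, Function.Bijective (F t) := by
    intro t
    have aux : ∀ x ∈ W, ∀ y ∉ f b '' W, f t x ≠ G t y := by
      intro x hx y hy hxy
      have : f t x ∈ f t '' W := ⟨x, hx, rfl⟩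
      rw [← hPQ t] at this
      obtain ⟨z, hz, hz'⟩ := this
      exact hy ⟨z, hz, (hGbij t).1 (hz'.trans hxy)⟩
    constructor
    · intro x y hxy
      by_cases hx : x ∈ f b '' W <;> by_cases hy : y ∈ f b '' W
      · obtain ⟨x, hx, rfl⟩ := hx
        obtain ⟨y, hy, rfl⟩ := hy
        rw [hF1 t x hx, hF1 t y hy] at hxy
        rw [hinj t hxy]
      · obtain ⟨x, hx, rfl⟩ := hx
        rw [hF1 t x hx, hF2 t y hy] at hxy
        exact (aux x hx y hy hxy).elim
      · obtain ⟨y, hy, rfl⟩ := hy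
        rw [hF1 t y hy, hF2 t x hx] at hxy
        exact (aux y hy x hx hxy.symm).elim
      · rw [hF2 t y hy, hF2 t x hx] at hxy
        exact (hGbij t).1 hxy
    · intro y
      obtain ⟨x, rfl⟩ := (hGbij t).2 y
      by_cases hx : x ∈ f b '' W
      · obtain ⟨x, hx, rfl⟩ := hx
        have : G t (f b x) ∈ f t '' W := by
          rw [← hPQ t]; exact ⟨x, hx, rfl⟩
        obtain ⟨z, hz, hz'⟩ := this
        exact ⟨f b z, by rw [hF1 t z hz, hz']⟩
      · exact ⟨x, hF2 t x hx⟩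
  refine ⟨N, hN, F, hFc, fun t => iso_of_LB (hFbij t) (hFlb t),
    ⟨interior W, isOpen_interior, hCW, fun t x hx => hF1 t x (interior_subset hx)⟩, ?_⟩
  intro hCc
  refine ⟨W ∪ K, (hCc.union hK1).union hK, hCW.trans (interior_mono subset_union_left), ?_⟩
  intro t x hx
  rw [mem_union, not_or] at hx
  rw [hF2 t _ (by rw [(hinj b).mem_set_image]; exact hx.1), hG1, hEK t x hx.2]

end Main

/-- **Lipschitz isotopy extension theorem** (Theorem 1.1).  Let `B` be a locally connected
metric space, `X` a locally compact and locally connected metric space, `V` a metric space and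
`f t : V → X` (`t ∈ B`) a continuous family of open Lipschitz embeddings.  Let `C ⊆ V` be closed
with compact boundary, with `f t '' C` closed in `X` for all `t`.  If `L(V − C)` holds, then for
each `b ∈ B` there are a neighbourhood `N` of `b` and a continuous family of Lipschitz
isomorphisms `F t : X → X` (`t ∈ N`) with `F t ∘ f b = f t` near `C`; moreover if `C` is compact
the `F t` may be chosen so that in addition `F t ∘ f b = f b` away from a compact neighbourhood
of `C`. -/
theorem lipschitz_isotopy_extension
    {B : Type u} {X : Type v} {V : Type w}
    [MetricSpace B] [LocallyConnectedSpace B]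
    [MetricSpace X] [LocallyCompactSpace X] [LocallyConnectedSpace X]
    [MetricSpace V]
    (f : B → V → X)
    (hcont : Continuous fun q : B × V => f q.1 q.2)
    (hemb : ∀ t, IsOpenLipschitzEmbedding (f t))
    (C : Set V) (hC : IsClosed C) (hbd : IsCompact (frontier C))
    (hCcl : ∀ t, IsClosed (f t '' C))
    (hL : LipschitzDeformationPrinciple ↥(Cᶜ)) :
    ∀ b : B,
      (∃ N ∈ 𝓝 b, ∃ F : ↥N → X → X,
        Continuous (fun q : ↥N × X => F q.1 q.2) ∧
        (∀ t, IsLipschitzIso (F t)) ∧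
        (∃ W, IsOpen W ∧ C ⊆ W ∧ ∀ t : ↥N, ∀ x ∈ W, F t (f b x) = f (t : B) x)) ∧
      (IsCompact C →
        ∃ N ∈ 𝓝 b, ∃ F : ↥N → X → X,
          Continuous (fun q : ↥N × X => F q.1 q.2) ∧
          (∀ t, IsLipschitzIso (F t)) ∧
          (∃ W, IsOpen W ∧ C ⊆ W ∧ ∀ t : ↥N, ∀ x ∈ W, F t (f b x) = f (t : B) x) ∧
          (∃ K : Set V, IsCompact K ∧ C ⊆ interior K ∧
            ∀ t : ↥N, ∀ x ∉ K, F t (f b x) = f b x)) := by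
  intro b
  obtain ⟨N, hN, F, h1, h2, h3, h4⟩ := stage_two f hcont hemb C hC hbd hCcl hL b
  exact ⟨⟨N, hN, F, h1, h2, h3⟩, fun hc => ⟨N, hN, F, h1, h2, h3, h4 hc⟩⟩
end

section
/- Let p : E → X be a Lipschitz submersion between metric spaces with X locally compact and locally connected. Let y ∈ E, b = p(y), and F = p⁻¹(b). Assume F is locally connected and locally compact and that the refined Lipschitz deformation principle L*(F) holds. Then for every compact subset C of F there exist an open neighborhood U of C in F, a neighborhood N of b in X, and a Lipschitz product chart f : U × N → E about U for p. -/
open Topology Metric Set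

universe u v

section Isotopy

/-- A Lipschitz isotopy: an open embedding between products of metric spaces which respects
the projection onto the first factor and is a Lipschitz isomorphism onto its image
(i.e. a Lipschitz embedding). -/
def IsLipschitzIsotopy {B X Y : Type*} [MetricSpace B] [MetricSpace X] [MetricSpace Y]
    (F : B × X → B × Y) : Prop :=
  IsOpenEmbedding F ∧ (∀ q, (F q).1 = q.1) ∧ IsLipschitzEmbedding F

/-- The refined principle `L*(X)`: `L(X)` where the deformation rule additionally satisfies
property `(P)`: it turns Lipschitz isotopies into Lipschitz isotopies. -/
def LipschitzDeformationPrincipleStar (X : Type v) [MetricSpace X] : Prop :=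
  ∀ U : Set X, IsOpen U → ∀ C : Set X, IsCompact C → C ⊆ U →
    ∃ N ∈ 𝓝 (inclCM U), ∃ D : C(↥U, X) → C(X, X), DeformationData U C N D ∧
      ∀ (B : Type u) [MetricSpace B] (h : B → C(↥U, X)),
        (∀ t, h t ∈ N ∧ IsOpenLipschitzEmbedding (⇑(h t) : ↥U → X)) →
        IsLipschitzIsotopy (fun q : B × ↥U => (q.1, h q.1 q.2)) →
        IsLipschitzIsotopy (fun q : B × X => (q.1, D (h q.1) q.2))

end Isotopy

section Submersion

variable {E X : Type*}

/-- A Lipschitz product chart about an open subset `U` of the fiber `p ⁻¹ b` for `p`. -/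
def IsLipschitzProductChart [MetricSpace E] [MetricSpace X] (p : E → X) (b : X)
    (U : Set (p ⁻¹' {b})) (N : Set X) (f : ↥U × ↥N → E) : Prop :=
  IsOpenLipschitzEmbedding f ∧
    (∀ z : ↥U × ↥N, p (f z) = (z.2 : X)) ∧
    (∀ (u : ↥U) (hb : b ∈ N), f (u, ⟨b, hb⟩) = ((u : ↥(p ⁻¹' {b})) : E))

/-- A Lipschitz submersion: a Lipschitz map which, near every point of `E`, admits a Lipschitz
product chart about an open neighbourhood of the point in its fiber, onto a neighbourhood of
the point. -/
def IsLipschitzSubmersion [MetricSpace E] [MetricSpace X] (p : E → X) : Prop :=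
  LocallyLipschitz p ∧
    ∀ y : E, ∃ U : Set (p ⁻¹' {p y}), ∃ N : Set X, ∃ f : ↥U × ↥N → E,
      IsOpen U ∧ (⟨y, rfl⟩ : ↥(p ⁻¹' {p y})) ∈ U ∧ N ∈ 𝓝 (p y) ∧
      IsLipschitzProductChart p (p y) U N f ∧ Set.range f ∈ 𝓝 y

end Submersion

namespace LSub
open Filter
open scoped NNReal

/-- local open bi-Lipschitz -/
def L {X Y : Type*} [MetricSpace X] [MetricSpace Y] (f : X → Y) (x : X) : Prop :=
  𝓝 (f x) ≤ map f (𝓝 x) ∧ ∃ K : ℝ, 0 ≤ K ∧ ∃ U ∈ 𝓝 x, ∀ a ∈ U, ∀ c ∈ U,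
    dist (f a) (f c) ≤ K * dist a c ∧ dist a c ≤ K * dist (f a) (f c)

variable {X Y Z W : Type*} [MetricSpace X] [MetricSpace Y] [MetricSpace Z] [MetricSpace W]

lemma L.image {f : X → Y} {x : X} (h : L f x) {V : Set X} (hV : V ∈ 𝓝 x) : f '' V ∈ 𝓝 (f x) :=
  h.1 (image_mem_map hV)

lemma L.cont {f : X → Y} {x : X} (h : L f x) : ContinuousAt f x := by
  obtain ⟨-, K, hK, U, hU, hf⟩ := h
  have hxU := mem_of_mem_nhds hU
  rw [ContinuousAt, tendsto_iff_dist_tendsto_zero]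
  have h1 : Tendsto (fun a => K * dist a x) (𝓝 x) (𝓝 0) := by
    have : Tendsto (fun a => K * dist a x) (𝓝 x) (𝓝 (K * dist x x)) :=
      Continuous.tendsto (by fun_prop) x
    simpa using this
  refine tendsto_of_tendsto_of_tendsto_of_le_of_le' tendsto_const_nhds h1 ?_ ?_
  · exact Eventually.of_forall fun a => dist_nonneg
  · filter_upwards [hU] with a ha using (hf a ha x hxU).1

lemma L.inj {f : X → Y} {x : X} (h : L f x) : ∃ U ∈ 𝓝 x, InjOn f U := by
  obtain ⟨-, K, hK, U, hU, hf⟩ := h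
  refine ⟨U, hU, fun a ha c hc hac => ?_⟩
  have := (hf a ha c hc).2
  rw [hac, dist_self, mul_zero] at this
  exact dist_le_zero.1 this

lemma L.congr {f g : X → Y} {x : X} (h : L f x) (hfg : f =ᶠ[𝓝 x] g) : L g x := by
  obtain ⟨h1, K, hK, U, hU, hf⟩ := h
  refine ⟨?_, K, hK, U ∩ {z | f z = g z}, inter_mem hU hfg, ?_⟩
  · rw [← hfg.eq_of_nhds, ← map_congr hfg]; exact h1
  · rintro a ⟨ha, ha'⟩ c ⟨hc, hc'⟩
    rw [← show f a = g a from ha', ← show f c = g c from hc']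
    exact hf a ha c hc

lemma L_id (x : X) : L (id : X → X) x :=
  ⟨by simp, 1, zero_le_one, univ, univ_mem, by simp⟩

lemma L.comp {f : X → Y} {g : Y → Z} {x : X} (hg : L g (f x)) (hf : L f x) : L (g ∘ f) x := by
  have hc := hf.cont
  obtain ⟨h1, K, hK, U, hU, hf⟩ := hf
  obtain ⟨h1', K', hK', U', hU', hg⟩ := hg
  refine ⟨?_, K * K', by positivity, U ∩ f ⁻¹' U', inter_mem hU (hc hU'), ?_⟩
  · rw [← map_map]; exact h1'.trans (map_mono h1)
  · rintro a ⟨ha, ha'⟩ c ⟨hc, hc'⟩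
    have e1 := hf a ha c hc
    have e2 := hg _ ha' _ hc'
    have e3 := mul_le_mul_of_nonneg_left e1.1 hK'
    have e4 := mul_le_mul_of_nonneg_left e2.2 hK
    constructor
    · simp only [Function.comp]; linarith
    · simp only [Function.comp]; linarith

lemma L.of_comp_left {h : X → Y} {g : Y → Z} {x : X} (hg : L g (h x)) (hgh : L (g ∘ h) x)
    (hc : ContinuousAt h x) : L h x := by
  obtain ⟨Ui, hUi, hinj⟩ := hg.inj
  have gc := hg.cont
  obtain ⟨h1, K, hK, U, hU, hgh⟩ := hgh
  obtain ⟨h1', K', hK', U', hU', hg⟩ := hg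
  refine ⟨?_, K * K', by positivity, U ∩ h ⁻¹' U', inter_mem hU (hc hU'), ?_⟩
  · intro S hS
    have hS1 : h ⁻¹' S ∩ h ⁻¹' Ui ∈ 𝓝 x := inter_mem hS (hc hUi)
    have h2 : (g ∘ h) '' (h ⁻¹' S ∩ h ⁻¹' Ui) ∈ 𝓝 (g (h x)) := h1 (image_mem_map hS1)
    filter_upwards [gc h2, hUi] with w hw hwU
    obtain ⟨a, ⟨ha, haU⟩, hag⟩ := hw
    have : h a = w := hinj haU hwU hag
    exact this ▸ ha
  · rintro a ⟨ha, ha'⟩ c ⟨hc, hc'⟩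
    have e1 := hgh a ha c hc
    have e2 := hg _ ha' _ hc'
    simp only [Function.comp] at e1
    have e3 := mul_le_mul_of_nonneg_left e1.1 hK'
    have e4 := mul_le_mul_of_nonneg_left e2.1 hK
    constructor <;> linarith

lemma L.of_comp_right {f : X → Y} {g : Y → Z} {x : X} (hf : L f x) (hgf : L (g ∘ f) x) :
    L g (f x) := by
  have fc := hf.cont
  obtain ⟨h1, K, hK, U, hU, hgf⟩ := hgf
  obtain ⟨h1', K', hK', U', hU', hf⟩ := hf
  refine ⟨?_, K * K', by positivity, f '' (U ∩ U'), h1' (image_mem_map (inter_mem hU hU')), ?_⟩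
  · refine h1.trans ?_
    rw [← map_map]; exact map_mono fc
  · rintro _ ⟨a, ⟨ha, ha'⟩, rfl⟩ _ ⟨c, ⟨hc, hc'⟩, rfl⟩
    have e1 := hgf a ha c hc
    have e2 := hf _ ha' _ hc'
    simp only [Function.comp] at e1
    have e3 := mul_le_mul_of_nonneg_left e1.2 hK'
    have e4 := mul_le_mul_of_nonneg_left e2.2 hK
    constructor <;> linarith

lemma L_val {S : Set X} (x : S) (hS : S ∈ 𝓝 (x : X)) : L (Subtype.val : S → X) x := by
  refine ⟨?_, 1, zero_le_one, univ, univ_mem, ?_⟩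
  · rw [map_nhds_subtype_val, nhdsWithin_eq_nhds.2 hS]
  · intro a _ c _; simp [Subtype.dist_eq]

lemma L_swap (z : X × Y) : L (Prod.swap : X × Y → Y × X) z := by
  refine ⟨?_, 1, zero_le_one, univ, univ_mem, ?_⟩
  · have := (Homeomorph.prodComm X Y).map_nhds_eq z
    exact this.ge
  · intro a _ c _; simp [Prod.dist_eq, max_comm]

lemma L.prodMap {f : X → Y} {g : Z → W} {z : X × Z} (hf : L f z.1) (hg : L g z.2) :
    L (Prod.map f g) z := by
  obtain ⟨x, w⟩ := z
  obtain ⟨h1, K, hK, U, hU, hf⟩ := hf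
  obtain ⟨h1', K', hK', U', hU', hg⟩ := hg
  refine ⟨?_, max K K', by positivity, U ×ˢ U', prod_mem_nhds hU hU', ?_⟩
  · simp only [Prod.map, nhds_prod_eq]
    rw [← Filter.prod_map_map_eq']
    exact Filter.prod_mono h1 h1'
  · rintro a ⟨ha, ha'⟩ c ⟨hc, hc'⟩
    have e1 := hf _ ha _ hc
    have e2 := hg _ ha' _ hc'
    simp only [Prod.dist_eq, Prod.map]
    have k1 : K ≤ max K K' := le_max_left _ _
    have k2 : K' ≤ max K K' := le_max_right _ _
    have k0 : 0 ≤ max K K' := hK.trans k1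
    constructor
    · apply max_le
      · exact e1.1.trans (mul_le_mul k1 (le_max_left _ _) dist_nonneg k0)
      · exact e2.1.trans (mul_le_mul k2 (le_max_right _ _) dist_nonneg k0)
    · apply max_le
      · exact e1.2.trans (mul_le_mul k1 (le_max_left _ _) dist_nonneg k0)
      · exact e2.2.trans (mul_le_mul k2 (le_max_right _ _) dist_nonneg k0)

lemma ole_of_L {f : X → Y} (hi : Function.Injective f) (h : ∀ x, L f x) :
    IsOpenLipschitzEmbedding f := by
  refine ⟨⟨hi, ?_, ?_⟩, ?_⟩
  · intro x
    obtain ⟨-, K, hK, U, hU, hf⟩ := h x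
    exact ⟨⟨K, hK⟩, U, hU, LipschitzOnWith.of_dist_le_mul fun a ha c hc => (hf a ha c hc).1⟩
  · have hl : Function.LeftInverse (fun y : range f => y.2.choose) (rangeFactorization f) := by
      intro x
      exact hi (rangeFactorization f x).2.choose_spec
    refine ⟨fun y => y.2.choose, hl, ?_⟩
    rintro ⟨_, x, rfl⟩
    have hLx := h x
    obtain ⟨-, K, hK, U, hU, hf⟩ := h x
    refine ⟨⟨K, hK⟩, Subtype.val ⁻¹' (f '' U),
      continuous_subtype_val.continuousAt (hLx.image hU), ?_⟩
    apply LipschitzOnWith.of_dist_le_mul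
    rintro ⟨_, hya⟩ ⟨a, ha, rfl⟩ ⟨_, hyc⟩ ⟨c, hc, rfl⟩
    have h1 := hl a
    have h2 := hl c
    simp only [rangeFactorization] at h1 h2
    have := (hf a ha c hc).2
    simp only [h1, h2]
    exact this
  · rw [isOpen_iff_mem_nhds]
    rintro _ ⟨x, rfl⟩
    have := (h x).image univ_mem
    rwa [image_univ] at this

lemma isOpenEmb_of_ole {f : X → Y} (h : IsOpenLipschitzEmbedding f) : IsOpenEmbedding f := by
  obtain ⟨⟨hi, hl, g, hg, hgl⟩, ho⟩ := h
  refine ⟨?_, ho⟩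
  have : IsEmbedding (rangeFactorization f) :=
    Topology.IsEmbedding.of_leftInverse hg hgl.continuous (hl.continuous.subtype_mk _)
  exact IsEmbedding.subtypeVal.comp this

lemma L_of_ole {f : X → Y} (h : IsOpenLipschitzEmbedding f) (x : X) : L f x := by
  have hoe := isOpenEmb_of_ole h
  obtain ⟨⟨hi, hl, g, hg, hgl⟩, ho⟩ := h
  refine ⟨(hoe.map_nhds_eq x).ge, ?_⟩
  obtain ⟨K, U, hU, hf⟩ := hl x
  obtain ⟨K', U', hU', hf'⟩ := hgl (rangeFactorization f x)
  have hcf : Continuous (rangeFactorization f) := hl.continuous.subtype_mk _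
  refine ⟨max K K', by positivity, U ∩ rangeFactorization f ⁻¹' U',
    inter_mem hU (hcf.continuousAt hU'), ?_⟩
  rintro a ⟨ha, ha'⟩ c ⟨hc, hc'⟩
  have e1 := hf.dist_le_mul a ha c hc
  have e2 := hf'.dist_le_mul _ ha' _ hc'
  rw [hg a, hg c, Subtype.dist_eq] at e2
  exact ⟨e1.trans (mul_le_mul_of_nonneg_right (le_max_left _ _) dist_nonneg),
    e2.trans (mul_le_mul_of_nonneg_right (le_max_right _ _) dist_nonneg)⟩

lemma isotopy_of_L {f : X × Y → X × Z} (hi : Function.Injective f) (h : ∀ x, L f x)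
    (hp : ∀ q, (f q).1 = q.1) : IsLipschitzIsotopy f :=
  ⟨isOpenEmb_of_ole (ole_of_L hi h), hp, (ole_of_L hi h).1⟩

lemma L_of_isotopy {f : X × Y → X × Z} (h : IsLipschitzIsotopy f) (q) : L f q :=
  L_of_ole ⟨h.2.2, h.1.isOpen_range⟩ q

lemma L_slice {h : X → Y → Z} {t : X} {x : Y} (H : L (fun q : X × Y => (q.1, h q.1 q.2)) (t, x)) :
    L (h t) x := by
  obtain ⟨h1, K, hK, U, hU, hf⟩ := H
  have hct : ContinuousAt (fun a : Y => (t, a)) x := by fun_prop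
  refine ⟨?_, K, hK, (fun a => (t, a)) ⁻¹' U, hct hU, ?_⟩
  · intro S hS
    rw [mem_map] at hS
    have hS' : {q : X × Y | q.2 ∈ h t ⁻¹' S} ∈ 𝓝 (t, x) :=
      continuousAt_snd (p := (t, x)) hS
    have h2 := h1 (image_mem_map hS')
    have hct' : ContinuousAt (fun a : Z => (t, a)) (h t x) := by fun_prop
    filter_upwards [hct' h2] with w hw
    obtain ⟨⟨t', a⟩, ha, hq⟩ := hw
    simp only [Prod.mk.injEq] at hq
    obtain ⟨rfl, rfl⟩ := hq
    exact ha
  · intro a ha c hc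
    have := hf _ ha _ hc
    simpa [Prod.dist_eq] using this


structure Chart {E X : Type*} [MetricSpace E] [MetricSpace X] (p : E → X) (b : X)
    (U : Set (p ⁻¹' {b})) (N : Set X) (f : (p ⁻¹' {b}) × X → E) : Prop where
  oU : IsOpen U
  oN : IsOpen N
  hb : b ∈ N
  inj : InjOn f (U ×ˢ N)
  loc : ∀ z ∈ U ×ˢ N, L f z
  proj : ∀ z ∈ U ×ˢ N, p (f z) = z.2
  base : ∀ u ∈ U, f (u, b) = (u : E)

section
universe w
variable {E X : Type w} [MetricSpace E] [MetricSpace X] {p : E → X} {b : X}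

lemma Chart.mono {U U' : Set (p ⁻¹' {b})} {N N' : Set X} {f : (p ⁻¹' {b}) × X → E}
    (h : Chart p b U N f) (hU : U' ⊆ U) (hN : N' ⊆ N) (oU : IsOpen U') (oN : IsOpen N')
    (hb : b ∈ N') : Chart p b U' N' f :=
  ⟨oU, oN, hb, h.inj.mono (prod_mono hU hN), fun z hz => h.loc z (prod_mono hU hN hz),
    fun z hz => h.proj z (prod_mono hU hN hz), fun u hu => h.base u (hU hu)⟩

lemma Chart.toProduct {U : Set (p ⁻¹' {b})} {N : Set X} {f : (p ⁻¹' {b}) × X → E}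
    (h : Chart p b U N f) :
    IsLipschitzProductChart p b U N (f ∘ Prod.map Subtype.val Subtype.val) := by
  have hm : ∀ z : U × N, Prod.map Subtype.val Subtype.val z ∈ U ×ˢ N := fun z => ⟨z.1.2, z.2.2⟩
  refine ⟨ole_of_L ?_ ?_, ?_, ?_⟩
  · intro z z' hz
    have := h.inj (hm z) (hm z') hz
    exact (Subtype.val_injective.prodMap Subtype.val_injective) this
  · intro z
    exact (h.loc _ (hm z)).comp
      (L.prodMap (L_val _ (h.oU.mem_nhds z.1.2)) (L_val _ (h.oN.mem_nhds z.2.2)))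
  · intro z; exact h.proj _ (hm z)
  · intro u hb; exact h.base _ u.2

lemma local_chart (hp : IsLipschitzSubmersion p) (x : p ⁻¹' {b}) :
    ∃ U N f, Chart p b U N f ∧ x ∈ U := by
  obtain ⟨x, hx⟩ := x
  cases hx
  obtain ⟨U, N, f, hU, hxU, hN, ⟨hf1, hf2, hf3⟩, -⟩ := hp.2 x
  classical
  let f' : (p ⁻¹' {p x}) × X → E := fun z =>
    if h : z.1 ∈ U ∧ z.2 ∈ N then f (⟨z.1, h.1⟩, ⟨z.2, h.2⟩) else x
  have hf' : ∀ u (hu : u ∈ U) t (ht : t ∈ N), f' (u, t) = f (⟨u, hu⟩, ⟨t, ht⟩) := by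
    intro u hu t ht
    simp only [f']
    rw [dif_pos ⟨hu, ht⟩]
  have hi : interior N ⊆ N := interior_subset
  refine ⟨U, interior N, f', ⟨hU, isOpen_interior, mem_interior_iff_mem_nhds.2 hN, ?_, ?_, ?_, ?_⟩,
    hxU⟩
  · rintro ⟨u, t⟩ ⟨hu, ht⟩ ⟨u', t'⟩ ⟨hu', ht'⟩ he
    rw [hf' u hu t (hi ht), hf' u' hu' t' (hi ht')] at he
    have := hf1.1.1 he
    simp only [Prod.mk.injEq, Subtype.mk.injEq] at this
    exact Prod.ext this.1 this.2
  · rintro ⟨u, t⟩ ⟨hu, ht⟩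
    have h1 : L (Prod.map Subtype.val Subtype.val : U × N → _ × X) (⟨u, hu⟩, ⟨t, hi ht⟩) :=
      L.prodMap (L_val _ (hU.mem_nhds hu)) (L_val _ (mem_interior_iff_mem_nhds.1 ht))
    have key := fun H => L.of_comp_right (g := f') h1 H
    refine key ?_
    have : f' ∘ (Prod.map Subtype.val Subtype.val : U × N → _ × X) = f := by
      funext z
      exact hf' _ z.1.2 _ z.2.2
    rw [this]
    exact L_of_ole hf1 _
  · rintro ⟨u, t⟩ ⟨hu, ht⟩
    rw [hf' u hu t (hi ht)]
    exact hf2 _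
  · intro u hu
    rw [hf' u hu (p x) (mem_of_mem_nhds hN)]
    exact hf3 ⟨u, hu⟩ _

/-- gluing two charts that agree near `A ∩ B` -/
lemma glue [LocallyCompactSpace (p ⁻¹' {b})] {U V : Set (p ⁻¹' {b})} {N : Set X}
    {f g : (p ⁻¹' {b}) × X → E} (hf : Chart p b U N f) (hg : Chart p b V N g)
    {A B K : Set (p ⁻¹' {b})} (hA : IsCompact A) (hB : IsCompact B) (hAU : A ⊆ U) (hBV : B ⊆ V)
    (hK : A ∩ B ⊆ interior K) (hfg : ∀ x ∈ K, ∀ t ∈ N, f (x, t) = g (x, t)) :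
    ∃ U' N' k, Chart p b U' N' k ∧ A ∪ B ⊆ U' := by
  classical
  obtain ⟨O₁, O₂, hO₁, hO₂, hAO, hBO, hd⟩ : SeparatedNhds (A \ interior K) (B \ interior K) := by
    apply SeparatedNhds.of_isCompact_isCompact (hA.diff isOpen_interior) (hB.diff isOpen_interior)
    rw [Set.disjoint_left]
    rintro x ⟨hx, hx'⟩ ⟨hy, -⟩
    exact hx' (hK ⟨hx, hy⟩)
  set U' := (O₁ ∪ interior K) ∩ U with hU'
  set V' := (O₂ ∪ interior K) ∩ V with hV'
  have oU' : IsOpen U' := (hO₁.union isOpen_interior).inter hf.oU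
  have oV' : IsOpen V' := (hO₂.union isOpen_interior).inter hg.oU
  have hAU' : A ⊆ U' := fun x hx => ⟨by
    by_cases h : x ∈ interior K
    · exact Or.inr h
    · exact Or.inl (hAO ⟨hx, h⟩), hAU hx⟩
  have hBV' : B ⊆ V' := fun x hx => ⟨by
    by_cases h : x ∈ interior K
    · exact Or.inr h
    · exact Or.inl (hBO ⟨hx, h⟩), hBV hx⟩
  have hUV : ∀ x ∈ U', x ∈ V' → x ∈ K := by
    rintro x ⟨h1, -⟩ ⟨h2, -⟩
    rcases h1 with h1 | h1
    · rcases h2 with h2 | h2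
      · exact (Set.disjoint_left.1 hd h1 h2).elim
      · exact interior_subset h2
    · exact interior_subset h1
  let k : (p ⁻¹' {b}) × X → E := fun z => if z.1 ∈ U' then f z else g z
  have kf : ∀ z ∈ U' ×ˢ N, k z = f z := fun z hz => if_pos hz.1
  have kg : ∀ z ∈ V' ×ˢ N, k z = g z := by
    rintro ⟨x, t⟩ ⟨hx, ht⟩
    by_cases h : x ∈ U'
    · rw [kf (x, t) ⟨h, ht⟩]; exact hfg x (hUV x h hx) t ht
    · exact if_neg h
  have kL : ∀ z ∈ (U' ∪ V') ×ˢ N, L k z ∧ p (k z) = z.2 := by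
    rintro z ⟨hz | hz, ht⟩
    · have hz' : z ∈ U ×ˢ N := ⟨hz.2, ht⟩
      refine ⟨(hf.loc z hz').congr ?_, ?_⟩
      · filter_upwards [(oU'.prod hf.oN).mem_nhds ⟨hz, ht⟩] with w hw using (kf w hw).symm
      · rw [kf z ⟨hz, ht⟩]; exact hf.proj z hz'
    · have hz' : z ∈ V ×ˢ N := ⟨hz.2, ht⟩
      refine ⟨(hg.loc z hz').congr ?_, ?_⟩
      · filter_upwards [(oV'.prod hf.oN).mem_nhds ⟨hz, ht⟩] with w hw using (kg w hw).symm
      · rw [kg z ⟨hz, ht⟩]; exact hg.proj z hz'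
  have kb : ∀ x ∈ U' ∪ V', k (x, b) = x := by
    rintro x (hx | hx)
    · rw [kf (x, b) ⟨hx, hf.hb⟩]; exact hf.base x hx.2
    · rw [kg (x, b) ⟨hx, hf.hb⟩]; exact hg.base x hx.2
  obtain ⟨Q, hQ, hABQ, hQU⟩ := exists_compact_between (hA.union hB) (oU'.union oV')
    (union_subset_union hAU' hBV')
  have hev : ∀ᶠ t in 𝓝 b, ∀ q ∈ Q ×ˢ Q, k (q.1, t) = k (q.2, t) → q.1 = q.2 := by
    apply IsCompact.eventually_forall_of_forall_eventually (hQ.prod hQ)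
      (P := fun t q => k (q.1, t) = k (q.2, t) → q.1 = q.2)
    rintro ⟨x, x'⟩ ⟨hx, hx'⟩
    have hLx := (kL (x, b) ⟨hQU hx, hf.hb⟩).1
    have hLx' := (kL (x', b) ⟨hQU hx', hf.hb⟩).1
    have c1 : ContinuousAt (fun z : X × ((p ⁻¹' {b}) × (p ⁻¹' {b})) => (z.2.1, z.1))
      (b, (x, x')) := by fun_prop
    have c2 : ContinuousAt (fun z : X × ((p ⁻¹' {b}) × (p ⁻¹' {b})) => (z.2.2, z.1))
      (b, (x, x')) := by fun_prop
    by_cases hxx : x = x'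
    · subst hxx
      obtain ⟨S, hS, hinj⟩ := hLx.inj
      filter_upwards [c1 hS, c2 hS] with z h1 h2 he
      exact congrArg Prod.fst (hinj h1 h2 he)
    · have hne : k (x, b) ≠ k (x', b) := by
        rw [kb x (hQU hx), kb x' (hQU hx')]
        exact fun h => hxx (Subtype.ext h)
      have d1 : ContinuousAt (fun z : X × ((p ⁻¹' {b}) × (p ⁻¹' {b})) => k (z.2.1, z.1))
        (b, (x, x')) := ContinuousAt.comp (g := k) (f := fun z : X × ((p ⁻¹' {b}) × (p ⁻¹' {b})) =>
          (z.2.1, z.1)) hLx.cont c1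
      have d2 : ContinuousAt (fun z : X × ((p ⁻¹' {b}) × (p ⁻¹' {b})) => k (z.2.2, z.1))
        (b, (x, x')) := ContinuousAt.comp (g := k) (f := fun z : X × ((p ⁻¹' {b}) × (p ⁻¹' {b})) =>
          (z.2.2, z.1)) hLx'.cont c2
      filter_upwards [(d1.prodMk d2).eventually (isOpen_ne_fun continuous_fst continuous_snd |>.mem_nhds
        (show (k (x, b), k (x', b)) ∈ {q : E × E | q.1 ≠ q.2} from hne))] with z hz he
      exact (hz he).elim
  obtain ⟨N₁, hN₁, oN₁, hbN₁⟩ := _root_.eventually_nhds_iff.1 hev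
  refine ⟨interior Q, N₁ ∩ N, k, ⟨isOpen_interior, oN₁.inter hf.oN, ⟨hbN₁, hf.hb⟩,
    ?_, ?_, ?_, ?_⟩, hABQ⟩
  · rintro ⟨x, t⟩ ⟨hx, ht⟩ ⟨x', t'⟩ ⟨hx', ht'⟩ he
    have hx := interior_subset hx
    have hx' := interior_subset hx'
    have e1 := (kL (x, t) ⟨hQU hx, ht.2⟩).2
    have e2 := (kL (x', t') ⟨hQU hx', ht'.2⟩).2
    rw [he, e2] at e1
    simp only at e1
    subst e1
    have := hN₁ _ ht.1 (x, x') ⟨hx, hx'⟩ he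
    exact Prod.ext this rfl
  · rintro z ⟨hz, ht⟩
    exact (kL z ⟨hQU (interior_subset hz), ht.2⟩).1
  · rintro z ⟨hz, ht⟩
    exact (kL z ⟨hQU (interior_subset hz), ht.2⟩).2
  · intro u hu
    exact kb u (hQU (interior_subset hu))

/-- modify `g` so as to agree with `f` near `A ∩ B`. -/
lemma adjust [LocallyCompactSpace (p ⁻¹' {b})]
    (hL : LipschitzDeformationPrincipleStar.{w} (p ⁻¹' {b}))
    {U V : Set (p ⁻¹' {b})} {N M : Set X}
    {f g : (p ⁻¹' {b}) × X → E} (hf : Chart p b U N f) (hg : Chart p b V M g)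
    {A : Set (p ⁻¹' {b})} (hA : IsCompact A) (hAU : A ⊆ U ∩ V) :
    ∃ N' g' K, N' ⊆ N ∧ Chart p b V N' g' ∧ A ⊆ interior K ∧
      ∀ x ∈ K, ∀ t ∈ N', f (x, t) = g' (x, t) := by
  classical
  by_cases hne : Nonempty (p ⁻¹' {b})
  swap
  · refine ⟨N ∩ M, g, ∅, inter_subset_left, hg.mono subset_rfl inter_subset_right hg.oU
      (hf.oN.inter hg.oN) ⟨hf.hb, hg.hb⟩, fun x => (hne ⟨x⟩).elim, fun x => (hne ⟨x⟩).elim⟩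
  have : Nonempty X := ⟨b⟩
  obtain ⟨K, hKc, hAK, hKUV⟩ := exists_compact_between hA (hf.oU.inter hg.oU) hAU
  obtain ⟨K₂, hK₂c, hKK₂, hK₂UV⟩ := exists_compact_between hKc (hf.oU.inter hg.oU) hKUV
  set W := interior K₂ with hW
  have oW : IsOpen W := isOpen_interior
  have hWUV : W ⊆ U ∩ V := interior_subset.trans hK₂UV
  obtain ⟨NN, hNN, D, ⟨-, hDi, hD⟩, hP⟩ := hL W oW K hKc hKK₂
  -- the inverse of `g`
  let ginv : E → (p ⁻¹' {b}) × X := Function.invFunOn g (V ×ˢ M)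
  have ginv_l : ∀ z ∈ V ×ˢ M, ginv (g z) = z := fun z hz => hg.inj.leftInvOn_invFunOn hz
  have ginv_L : ∀ z ∈ V ×ˢ M, L ginv (g z) := by
    intro z hz
    refine L.of_comp_right (hg.loc z hz) ((L_id z).congr ?_)
    filter_upwards [(hg.oU.prod hg.oN).mem_nhds hz] with w hw using (ginv_l w hw).symm
  have himg : IsOpen (g '' (V ×ˢ M)) := by
    rw [isOpen_iff_mem_nhds]
    rintro _ ⟨z, hz, rfl⟩
    exact (hg.loc z hz).image ((hg.oU.prod hg.oN).mem_nhds hz)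
  have hev : ∀ᶠ t in 𝓝 b, ∀ x ∈ K₂, f (x, t) ∈ g '' (V ×ˢ M) := by
    apply IsCompact.eventually_forall_of_forall_eventually hK₂c
      (P := fun t x => f (x, t) ∈ g '' (V ×ˢ M))
    intro x hx
    have hLx := hf.loc (x, b) ⟨(hK₂UV hx).1, hf.hb⟩
    have d1 : ContinuousAt (fun z : X × (p ⁻¹' {b}) => f (z.2, z.1)) (b, x) :=
      ContinuousAt.comp (f := fun z : X × (p ⁻¹' {b}) => (z.2, z.1)) hLx.cont (by fun_prop)
    refine d1.eventually (himg.mem_nhds ?_)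
    refine ⟨(x, b), ⟨(hK₂UV hx).2, hg.hb⟩, ?_⟩
    simp only
    rw [hg.base x (hK₂UV hx).2, hf.base x (hK₂UV hx).1]
  obtain ⟨N₀, hN₀, oN₀, hbN₀⟩ := _root_.eventually_nhds_iff.1 hev
  set N₁ := N₀ ∩ (N ∩ M) with hN₁
  have oN₁ : IsOpen N₁ := oN₀.inter (hf.oN.inter hg.oN)
  have hbN₁ : b ∈ N₁ := ⟨hbN₀, hf.hb, hg.hb⟩
  let G : (p ⁻¹' {b}) × X → (p ⁻¹' {b}) × X := fun z => ginv (f z)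
  have G_mem : ∀ z ∈ W ×ˢ N₁, G z ∈ V ×ˢ M ∧ g (G z) = f z := by
    rintro ⟨x, t⟩ ⟨hx, ht⟩
    obtain ⟨z', hz', he⟩ := hN₀ t ht.1 x (interior_subset hx)
    simp only [G]
    rw [← he, ginv_l z' hz']
    exact ⟨hz', rfl⟩
  have hWN : ∀ z ∈ W ×ˢ N₁, z ∈ U ×ˢ N := fun z hz => ⟨(hWUV hz.1).1, hz.2.2.1⟩
  have G_snd : ∀ z ∈ W ×ˢ N₁, (G z).2 = z.2 := by
    intro z hz
    rw [← hg.proj _ (G_mem z hz).1, (G_mem z hz).2, hf.proj z (hWN z hz)]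
  have G_L : ∀ z ∈ W ×ˢ N₁, L G z := by
    intro z hz
    have h1 : L ginv (f z) := by
      rw [← (G_mem z hz).2]; exact ginv_L _ (G_mem z hz).1
    exact h1.comp (hf.loc z (hWN z hz))
  have G_inj : InjOn G (W ×ˢ N₁) := by
    intro z hz z' hz' he
    apply hf.inj (hWN z hz) (hWN z' hz')
    rw [← (G_mem z hz).2, ← (G_mem z' hz').2, he]
  have G_b : ∀ x ∈ W, G (x, b) = (x, b) := by
    intro x hx
    simp only [G]
    rw [hf.base x (hWUV hx).1, ← hg.base x (hWUV hx).2, ginv_l _ ⟨(hWUV hx).2, hg.hb⟩]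
  -- the family over N₁
  let c : N₁ × W → (p ⁻¹' {b}) := fun q => (G (q.2, q.1)).1
  have hc : Continuous c := by
    rw [continuous_iff_continuousAt]
    rintro ⟨t, x⟩
    have h1 : ContinuousAt G ((x : p ⁻¹' {b}), (t : X)) := (G_L _ ⟨x.2, t.2⟩).cont
    have h2 : ContinuousAt (fun q : N₁ × W => G (q.2, q.1)) (t, x) :=
      ContinuousAt.comp (g := G) (f := fun q : N₁ × W => ((q.2 : p ⁻¹' {b}), (q.1 : X)))
        (x := (t, x)) h1 (Continuous.continuousAt (by fun_prop))
    exact h2.fst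
  let h₁ : C(N₁, C(W, (p ⁻¹' {b}))) := ContinuousMap.curry ⟨c, hc⟩
  have h₁_apply : ∀ t x, h₁ t x = (G (x, t)).1 := fun t x => rfl
  have h₁_b : h₁ ⟨b, hbN₁⟩ = inclCM W := by
    ext x
    rw [h₁_apply, G_b _ x.2]
    rfl
  have hnb : h₁ ⁻¹' NN ∈ 𝓝 (⟨b, hbN₁⟩ : N₁) := by
    apply h₁.continuous.continuousAt
    rw [h₁_b]; exact hNN
  obtain ⟨N₂', hN₂', oN₂', hbN₂'⟩ := _root_.mem_nhds_iff.1 hnb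
  set N₂ : Set X := Subtype.val '' N₂' with hN₂
  have oN₂ : IsOpen N₂ := oN₁.isOpenMap_subtype_val _ oN₂'
  have hbN₂ : b ∈ N₂ := ⟨_, hbN₂', rfl⟩
  have hN₂₁ : N₂ ⊆ N₁ := by rintro _ ⟨t, -, rfl⟩; exact t.2
  let h : N₂ → C(W, (p ⁻¹' {b})) := fun t => h₁ ⟨t, hN₂₁ t.2⟩
  have h_apply : ∀ t x, h t x = (G (x, t)).1 := fun t x => rfl
  have h_mem : ∀ t, h t ∈ NN := by
    rintro ⟨_, t, ht, rfl⟩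
    exact hN₂' ht
  have hG : ∀ (t : N₂) (x : W), G (x, t) = (h t x, (t : X)) := fun t x =>
    Prod.ext rfl (G_snd _ ⟨x.2, hN₂₁ t.2⟩)
  have hΦc : Continuous (fun q : N₂ × W => (q.1, h q.1 q.2)) := by
    have : Continuous (fun q : N₂ × W => c (⟨q.1, hN₂₁ q.1.2⟩, q.2)) := hc.comp (by fun_prop)
    exact continuous_fst.prodMk this
  have hΦL : ∀ q, L (fun q : N₂ × W => (q.1, h q.1 q.2)) q := by
    rintro ⟨t, x⟩
    have hv : ∀ z : N₂ × (p ⁻¹' {b}), L (Prod.swap ∘ Prod.map (Subtype.val : N₂ → X) id) z :=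
      fun z => (L_swap _).comp (L.prodMap (L_val _ (oN₂.mem_nhds z.1.2)) (L_id _))
    refine L.of_comp_left (hv _) ?_ hΦc.continuousAt
    have h1 : L (Prod.swap ∘ Prod.map (Subtype.val : N₂ → X) (Subtype.val : W → _)) (t, x) :=
      (L_swap _).comp (L.prodMap (L_val _ (oN₂.mem_nhds t.2)) (L_val _ (oW.mem_nhds x.2)))
    have h2 := L.comp (f := Prod.swap ∘ Prod.map (Subtype.val : N₂ → X) (Subtype.val : W → _))
      (g := G) (x := (t, x)) (G_L _ ⟨x.2, hN₂₁ t.2⟩) h1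
    refine h2.congr (Eventually.of_forall ?_)
    rintro ⟨t, x⟩
    exact hG t x
  have hΦi : Function.Injective (fun q : N₂ × W => (q.1, h q.1 q.2)) := by
    rintro ⟨t, x⟩ ⟨t', x'⟩ he
    simp only [Prod.mk.injEq] at he
    obtain ⟨rfl, he⟩ := he
    have : G (x, t) = G (x', t) := by rw [hG, hG, he]
    have := G_inj ⟨x.2, hN₂₁ t.2⟩ ⟨x'.2, hN₂₁ t.2⟩ this
    exact Prod.ext rfl (Subtype.ext (congrArg Prod.fst this))
  have hole : ∀ t, IsOpenLipschitzEmbedding (h t : W → _) := by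
    intro t
    refine ole_of_L ?_ fun x => L_slice (h := fun t x => h t x) (hΦL (t, x))
    intro x x' he
    have : (t, x) = (t, x') := hΦi (by simp only [he])
    exact congrArg Prod.snd this
  have hΨ := hP N₂ h (fun t => ⟨h_mem t, hole t⟩) (isotopy_of_L hΦi hΦL fun _ => rfl)
  have hH := fun t => hD (h t) (h_mem t) (hole t)
  have hHb : ∀ x, D (h ⟨b, hbN₂⟩) x = x := by
    intro x
    have : h ⟨b, hbN₂⟩ = inclCM W := h₁_b
    rw [this, hDi]; rfl
  have hHV : ∀ t, ∀ x ∈ V, D (h t) x ∈ V := by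
    intro t x hx
    by_contra hn
    have h1 : D (h t) x ∉ W := fun hw => hn (hWUV hw).2
    have h2 := (hH t).2.2 _ h1
    have h3 := (hH t).1.1.1 h2
    rw [h3] at hn
    exact hn hx
  let H : (p ⁻¹' {b}) × X → (p ⁻¹' {b}) × X := fun z =>
    if ht : z.2 ∈ N₂ then (D (h ⟨z.2, ht⟩) z.1, z.2) else z
  have H_apply : ∀ x t (ht : t ∈ N₂), H (x, t) = (D (h ⟨t, ht⟩) x, t) := by
    intro x t ht
    simp only [H]
    rw [dif_pos ht]
  have H_mem : ∀ z ∈ V ×ˢ N₂, H z ∈ V ×ˢ M := by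
    rintro ⟨x, t⟩ ⟨hx, ht⟩
    rw [H_apply x t ht]
    exact ⟨hHV _ x hx, (hN₂₁ ht).2.2⟩
  have H_L : ∀ z ∈ V ×ˢ N₂, L H z := by
    rintro ⟨x, t⟩ ⟨hx, ht⟩
    have hv : ∀ z : N₂ × (p ⁻¹' {b}), L (Prod.swap ∘ Prod.map (Subtype.val : N₂ → X) id) z :=
      fun z => (L_swap _).comp (L.prodMap (L_val _ (oN₂.mem_nhds z.1.2)) (L_id _))
    have key := fun H' => L.of_comp_right (g := H) (hv (⟨t, ht⟩, x)) H'
    refine key ?_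
    refine L.congr ((hv _).comp (L_of_isotopy hΨ (⟨t, ht⟩, x))) (Eventually.of_forall ?_)
    rintro ⟨t, x⟩
    exact (H_apply x t t.2).symm
  have H_inj : InjOn H (V ×ˢ N₂) := by
    rintro ⟨x, t⟩ ⟨hx, ht⟩ ⟨x', t'⟩ ⟨hx', ht'⟩ he
    rw [H_apply x t ht, H_apply x' t' ht'] at he
    simp only [Prod.mk.injEq] at he
    obtain ⟨he, rfl⟩ := he
    exact Prod.ext ((hH _).1.1.1 he) rfl
  refine ⟨N₂, g ∘ H, K, fun t ht => (hN₂₁ ht).2.1, ⟨hg.oU, oN₂, hbN₂, ?_, ?_, ?_, ?_⟩, hAK, ?_⟩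
  · exact hg.inj.comp H_inj H_mem
  · exact fun z hz => (hg.loc _ (H_mem z hz)).comp (H_L z hz)
  · rintro ⟨x, t⟩ hz
    rw [Function.comp, hg.proj _ (H_mem _ hz), H_apply x t hz.2]
  · intro u hu
    rw [Function.comp, H_apply u b hbN₂, hHb, hg.base u hu]
  · intro x hx t ht
    have hxW : x ∈ W := hKK₂ hx
    have h1 := (hH ⟨t, ht⟩).2.1 ⟨x, hxW⟩ hx
    simp only at h1
    rw [Function.comp, H_apply x t ht, h1, ← hG ⟨t, ht⟩ ⟨x, hxW⟩]
    exact (G_mem (x, t) ⟨hxW, hN₂₁ ht⟩).2.symm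

lemma main_chart [LocallyCompactSpace (p ⁻¹' {b})] (hp : IsLipschitzSubmersion p)
    (hL : LipschitzDeformationPrincipleStar.{w} (p ⁻¹' {b}))
    (y₀ : E) {C : Set (p ⁻¹' {b})} (hC : IsCompact C) :
    ∃ A, IsCompact A ∧ C ⊆ A ∧ ∃ U N f, Chart p b U N f ∧ A ⊆ U := by
  refine hC.induction_on (p := fun C => ∃ A, IsCompact A ∧ C ⊆ A ∧
    ∃ U N f, Chart p b U N f ∧ A ⊆ U) ?_ ?_ ?_ ?_
  · exact ⟨∅, isCompact_empty, subset_rfl, ∅, univ, fun _ => y₀,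
      ⟨isOpen_empty, isOpen_univ, mem_univ _, by simp, by simp, by simp, by simp⟩, subset_rfl⟩
  · rintro s t hst ⟨A, hA, htA, h⟩
    exact ⟨A, hA, hst.trans htA, h⟩
  · rintro s t ⟨A, hA, hsA, U, N, f, hf, hAU⟩ ⟨B, hB, htB, V, M, g, hg, hBV⟩
    obtain ⟨N', g', K, hN', hg', hK, hfg⟩ := adjust hL hf hg (hA.inter hB)
      (inter_subset_inter hAU hBV)
    exact ⟨A ∪ B, hA.union hB, union_subset_union hsA htB,
      glue (hf.mono subset_rfl hN' hf.oU hg'.oN hg'.hb) hg' hA hB hAU hBV hK hfg⟩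
  · intro x hx
    obtain ⟨U, N, f, hf, hxU⟩ := local_chart hp x
    obtain ⟨A, hA, hxA, hAU⟩ := exists_compact_subset hf.oU hxU
    exact ⟨A, mem_nhdsWithin_of_mem_nhds (mem_interior_iff_mem_nhds.1 hxA), A, hA, subset_rfl,
      U, N, f, hf, hAU⟩

end

end LSub

/-- **Lipschitz fibration theorem, local form** (first part of Theorem 1.2).  Let
`p : E → X` be a Lipschitz submersion with `X` locally compact and locally connected, let
`F = p ⁻¹ (p y)` be locally connected and locally compact with `L*(F)`.  Then every compact
`C ⊆ F` admits an open neighbourhood `U` in `F` together with a Lipschitz product chart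
`f : U × N → E` about `U` for `p`. -/
theorem lipschitz_submersion_chart
    {E X : Type u} [MetricSpace E] [MetricSpace X]
    [LocallyCompactSpace X] [LocallyConnectedSpace X]
    (p : E → X) (hp : IsLipschitzSubmersion p) (y : E)
    [LocallyConnectedSpace ↥(p ⁻¹' {p y})] [LocallyCompactSpace ↥(p ⁻¹' {p y})]
    (hL : LipschitzDeformationPrincipleStar.{u} ↥(p ⁻¹' {p y}))
    (C : Set ↥(p ⁻¹' {p y})) (hC : IsCompact C) :
    ∃ U : Set ↥(p ⁻¹' {p y}), IsOpen U ∧ C ⊆ U ∧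
      ∃ N ∈ 𝓝 (p y), ∃ f : ↥U × ↥N → E, IsLipschitzProductChart p (p y) U N f := by
  obtain ⟨A, -, hCA, U, N, f, hf, hAU⟩ := LSub.main_chart hp hL y hC
  exact ⟨U, hf.oU, hCA.trans hAU, N, hf.oN.mem_nhds hf.hb, _, hf.toProduct⟩
end

section
/- Let p : E → X be a proper Lipschitz submersion between metric spaces with X locally compact and locally connected. Assume that for each x ∈ X the fiber p⁻¹(x) is locally connected and the refined Lipschitz deformation principle L*(p⁻¹(x)) holds. Then p is a locally trivial Lipschitz fiber bundle: every x ∈ X has a neighborhood N′ in X and a Lipschitz product chart h : p⁻¹(x) × N′ → E about p⁻¹(x) for p with h(p⁻¹(x) × N′) = p⁻¹(N′). -/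
open Topology Metric Set

universe u v

section Helpers

open Filter
open scoped NNReal ENNReal

/-- Locally bi-Lipschitz, local homeomorphism near `z`. -/
def GoodAt {A B : Type*} [MetricSpace A] [MetricSpace B] (f : A → B) (z : A) : Prop :=
  ∃ K : ℝ≥0, ∃ O ∈ 𝓝 z, LipschitzOnWith K f O ∧
    (∀ a ∈ O, ∀ b ∈ O, edist a b ≤ K * edist (f a) (f b)) ∧
    ∀ a ∈ O, map f (𝓝 a) = 𝓝 (f a)

namespace GoodAt

variable {A B C : Type*} [MetricSpace A] [MetricSpace B] [MetricSpace C]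

theorem map_nhds {f : A → B} {z : A} (h : GoodAt f z) : map f (𝓝 z) = 𝓝 (f z) := by
  obtain ⟨K, O, hO, -, -, h3⟩ := h
  exact h3 z (mem_of_mem_nhds hO)

theorem continuousAt {f : A → B} {z : A} (h : GoodAt f z) : ContinuousAt f z :=
  h.map_nhds.le

theorem eventually {f : A → B} {z : A} (h : GoodAt f z) : ∀ᶠ w in 𝓝 z, GoodAt f w := by
  obtain ⟨K, O, hO, h1, h2, h3⟩ := h
  filter_upwards [eventually_mem_nhds_iff.2 hO] with w hw
  exact ⟨K, O, hw, h1, h2, h3⟩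

theorem congr {f g : A → B} {z : A} (h : GoodAt f z) (e : f =ᶠ[𝓝 z] g) : GoodAt g z := by
  obtain ⟨K, O, hO, h1, h2, h3⟩ := h
  obtain ⟨V, hV, hVo, hz⟩ := _root_.mem_nhds_iff.1 e
  refine ⟨K, O ∩ V, inter_mem hO (hVo.mem_nhds hz), ?_, ?_, ?_⟩
  · intro a ha b hb
    have e1 : f a = g a := hV ha.2
    have e2 : f b = g b := hV hb.2
    rw [← e1, ← e2]
    exact h1 ha.1 hb.1
  · intro a ha b hb
    have e1 : f a = g a := hV ha.2
    have e2 : f b = g b := hV hb.2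
    rw [← e1, ← e2]
    exact h2 a ha.1 b hb.1
  · intro a ha
    have e1 : f a = g a := hV ha.2
    rw [← e1, ← h3 a ha.1]
    refine (Filter.map_congr ?_).symm
    filter_upwards [hVo.mem_nhds ha.2] with x hx using hV hx

theorem injOn {f : A → B} {z : A} (h : GoodAt f z) : ∃ O ∈ 𝓝 z, InjOn f O := by
  obtain ⟨K, O, hO, h1, h2, h3⟩ := h
  refine ⟨O, hO, fun a ha b hb hab => ?_⟩
  have := h2 a ha b hb
  rw [hab] at this
  simpa using this

theorem of_isometry {f : A → B} (hf : Isometry f) (ho : IsOpenMap f) (z : A) : GoodAt f z := by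
  refine ⟨1, univ, univ_mem, hf.lipschitz.lipschitzOnWith, fun a _ b _ => ?_, fun a _ => ?_⟩
  · simp [hf.edist_eq]
  · exact (IsOpenEmbedding.of_continuous_injective_isOpenMap hf.continuous hf.injective ho).map_nhds_eq a

theorem comp {f : A → B} {g : B → C} {z : A} (hg : GoodAt g (f z)) (hf : GoodAt f z) :
    GoodAt (g ∘ f) z := by
  have hc := hf.continuousAt
  obtain ⟨K, O, hO, h1, h2, h3⟩ := hf
  obtain ⟨K', O', hO', h1', h2', h3'⟩ := hg
  refine ⟨K' * K, O ∩ f ⁻¹' O', inter_mem hO (hc hO'), ?_, ?_, ?_⟩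
  · exact (h1'.comp (h1.mono inter_subset_left) (fun x hx => hx.2))
  · intro a ha b hb
    calc edist a b ≤ K * edist (f a) (f b) := h2 a ha.1 b hb.1
      _ ≤ K * (K' * edist (g (f a)) (g (f b))) := by
        gcongr; exact h2' _ ha.2 _ hb.2
      _ = _ := by push_cast; simp only [Function.comp]; ring
  · intro a ha
    rw [← Filter.map_map, h3 a ha.1, h3' _ ha.2]; rfl

theorem cancel_right {f : A → B} {g : B → C} {z : A} (hf : GoodAt f z) (hgf : GoodAt (g ∘ f) z) :
    GoodAt g (f z) := by
  have hm := hf.map_nhds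
  obtain ⟨K, O, hO, h1, h2, h3⟩ := hf
  obtain ⟨K', O', hO', h1', h2', h3'⟩ := hgf
  refine ⟨K' * K, f '' (O ∩ O'), ?_, ?_, ?_, ?_⟩
  · rw [← hm]; exact image_mem_map (inter_mem hO hO')
  · rintro _ ⟨a, ha, rfl⟩ _ ⟨b, hb, rfl⟩
    calc edist (g (f a)) (g (f b)) ≤ K' * edist a b := h1' ha.2 hb.2
      _ ≤ K' * (K * edist (f a) (f b)) := by
        gcongr; exact h2 a ha.1 b hb.1
      _ = _ := by push_cast; ring
  · rintro _ ⟨a, ha, rfl⟩ _ ⟨b, hb, rfl⟩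
    calc edist (f a) (f b) ≤ K * edist a b := h1 ha.1 hb.1
      _ ≤ K * (K' * edist (g (f a)) (g (f b))) := by
        gcongr; exact h2' a ha.2 b hb.2
      _ = _ := by push_cast; ring
  · rintro _ ⟨a, ha, rfl⟩
    rw [← h3 a ha.1, Filter.map_map, h3' a ha.2]; rfl

theorem cancel_left {f : A → B} {g : B → C} {z : A} (hc : Continuous f) (hg : GoodAt g (f z))
    (hgf : GoodAt (g ∘ f) z) : GoodAt f z := by
  obtain ⟨K, O, hO, h1, h2, h3⟩ := hg
  obtain ⟨V, hV, hVo, hz⟩ := _root_.mem_nhds_iff.1 hO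
  obtain ⟨K', O', hO', h1', h2', h3'⟩ := hgf
  refine ⟨K' * K, O' ∩ f ⁻¹' V, inter_mem hO' (hc.continuousAt (hVo.mem_nhds hz)), ?_, ?_, ?_⟩
  · intro a ha b hb
    calc edist (f a) (f b) ≤ K * edist (g (f a)) (g (f b)) := h2 _ (hV ha.2) _ (hV hb.2)
      _ ≤ K * (K' * edist a b) := by
        gcongr; exact h1' ha.1 hb.1
      _ = _ := by push_cast; ring
  · intro a ha b hb
    calc edist a b ≤ K' * edist (g (f a)) (g (f b)) := h2' a ha.1 b hb.1
      _ ≤ K' * (K * edist (f a) (f b)) := by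
        gcongr; exact h1 (hV ha.2) (hV hb.2)
      _ = _ := by push_cast; ring
  · intro a ha
    refine le_antisymm hc.continuousAt ?_
    intro S hS
    have hSn : f ⁻¹' S ∩ f ⁻¹' V ∈ 𝓝 a :=
      inter_mem hS (hc.continuousAt (hVo.mem_nhds ha.2))
    have h4 : g ∘ f '' (f ⁻¹' S ∩ f ⁻¹' V) ∈ 𝓝 (g (f a)) := by
      have := image_mem_map (m := g ∘ f) hSn
      rwa [h3' a ha.1] at this
    rw [← h3 _ (hV ha.2)] at h4
    filter_upwards [h4, hVo.mem_nhds ha.2] with y hy hyV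
    obtain ⟨w, hw, hwy⟩ := hy
    have : edist (f w) y ≤ K * edist (g (f w)) (g y) := h2 _ (hV hw.2) _ (hV hyV)
    have e : g (f w) = g y := hwy
    rw [e] at this
    have e2 : f w = y := by simpa using this
    rw [← e2]; exact hw.1

theorem id_good (z : A) : GoodAt (id : A → A) z := of_isometry isometry_id IsOpenMap.id z

/-- On a slice of a fiber-preserving map. -/
theorem slice {H : A × B → A × C} {t : A} {u : B} (h : GoodAt H (t, u))
    (hf : ∀ᶠ z in 𝓝 (t, u), (H z).1 = z.1) : GoodAt (fun v => (H (t, v)).2) u := by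
  obtain ⟨K, O, hO, h1, h2, h3⟩ := h
  obtain ⟨V, hV, hVo, hz⟩ := _root_.mem_nhds_iff.1 (inter_mem hO hf)
  have hct : Continuous (fun v : B => (t, v)) := by fun_prop
  refine ⟨K, (fun v : B => (t, v)) ⁻¹' V, hct.continuousAt (hVo.mem_nhds hz), ?_, ?_, ?_⟩
  · intro a ha b hb
    have h5 := h1 (hV ha).1 (hV hb).1
    have e1 : (H (t, a)).1 = t := (hV ha).2
    have e2 : (H (t, b)).1 = t := (hV hb).2
    simpa [Prod.edist_eq, e1, e2] using h5
  · intro a ha b hb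
    have h5 := h2 _ (hV ha).1 _ (hV hb).1
    have e1 : (H (t, a)).1 = t := (hV ha).2
    have e2 : (H (t, b)).1 = t := (hV hb).2
    simpa [Prod.edist_eq, e1, e2] using h5
  · intro a ha
    have hm := h3 _ (hV ha).1
    have e1 : (H (t, a)).1 = t := (hV ha).2
    apply le_antisymm
    · have : ContinuousAt H (t, a) := hm.le
      have h6 : ContinuousAt (fun v => H (t, v)) a :=
        ContinuousAt.comp (f := fun v : B => (t, v)) this hct.continuousAt
      exact h6.snd
    · intro S hS
      have hS' : {v | (H (t, v)).2 ∈ S} ∈ 𝓝 a := hS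
      have h7 : (Prod.snd ⁻¹' {v | (H (t, v)).2 ∈ S}) ∩ V ∈ 𝓝 (t, a) :=
        inter_mem (continuous_snd.continuousAt hS') (hVo.mem_nhds ha)
      have h8 := image_mem_map (m := H) h7
      rw [hm] at h8
      have h9 : Continuous (fun c : C => (t, c)) := by fun_prop
      have h10 : H (t, a) = (t, (H (t, a)).2) := Prod.ext e1 rfl
      rw [h10] at h8
      filter_upwards [h9.continuousAt h8] with c hc
      obtain ⟨⟨t', v⟩, hw, hwc⟩ := hc
      have e3 : (H (t', v)).1 = t' := (hV hw.2).2
      rw [hwc] at e3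
      simp only at e3
      subst e3
      have h11 : (H (t, v)).2 ∈ S := hw.1
      rwa [hwc] at h11

end GoodAt

theorem IsOpenLipschitzEmbedding.goodAt {A B : Type*} [MetricSpace A] [MetricSpace B] {f : A → B}
    (h : IsOpenLipschitzEmbedding f) (z : A) : GoodAt f z := by
  obtain ⟨⟨hi, hl, g, hg, hgl⟩, ho⟩ := h
  have hfc : Continuous (Set.rangeFactorization f) :=
    hl.continuous.subtype_mk _
  have hind : IsInducing f := by
    have h1 : IsInducing (Set.rangeFactorization f) :=
      (Topology.IsEmbedding.of_leftInverse hg hgl.continuous hfc).isInducing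
    exact IsInducing.subtypeVal.comp h1
  have hoe : IsOpenEmbedding f := ⟨⟨hind, hi⟩, ho⟩
  obtain ⟨K, O, hO, h1⟩ := hl z
  obtain ⟨K', O', hO', h1'⟩ := hgl (Set.rangeFactorization f z)
  refine ⟨max K K', O ∩ Set.rangeFactorization f ⁻¹' O',
    inter_mem hO (hfc.continuousAt hO'), ?_, ?_, fun a _ => hoe.map_nhds_eq a⟩
  · exact (h1.mono inter_subset_left).weaken (le_max_left _ _)
  · intro a ha b hb
    have := (h1'.weaken (le_max_right K K')) ha.2 hb.2
    rw [hg, hg] at this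
    exact this

theorem isOpenEmbedding_of_goodAt {A B : Type*} [MetricSpace A] [MetricSpace B] {f : A → B}
    (hi : Function.Injective f) (h : ∀ z, GoodAt f z) : IsOpenEmbedding f :=
  IsOpenEmbedding.of_continuous_injective_isOpenMap
    (continuous_iff_continuousAt.2 fun z => (h z).continuousAt) hi
    (isOpenMap_iff_nhds_le.2 fun z => (h z).map_nhds.ge)

theorem isOpenLipschitzEmbedding_of_goodAt {A B : Type*} [MetricSpace A] [MetricSpace B]
    {f : A → B} (hi : Function.Injective f) (h : ∀ z, GoodAt f z) :
    IsOpenLipschitzEmbedding f := by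
  have hoe := isOpenEmbedding_of_goodAt hi h
  refine ⟨⟨hi, fun z => ?_, fun y => y.2.choose, ?_, ?_⟩, hoe.isOpen_range⟩
  · obtain ⟨K, O, hO, h1, -⟩ := h z
    exact ⟨K, O, hO, h1⟩
  · intro a
    exact hi (Set.rangeFactorization f a).2.choose_spec
  · rintro ⟨_, z, rfl⟩
    obtain ⟨K, O, hO, h1, h2, h3⟩ := h z
    refine ⟨K, Subtype.val ⁻¹' (f '' O), ?_, ?_⟩
    · apply continuous_subtype_val.continuousAt
      change f '' O ∈ 𝓝 (f z)
      rw [← (h z).map_nhds]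
      exact image_mem_map hO
    · intro w hw w' hw'
      obtain ⟨a, ha, haw⟩ := hw
      obtain ⟨b, hb, hbw⟩ := hw'
      have key : ∀ (w : Set.range f) (c : A), f c = w → w.2.choose = c := by
        intro w c hc
        apply hi
        rw [w.2.choose_spec, hc]
      change edist w.2.choose w'.2.choose ≤ K * edist (w : B) (w' : B)
      rw [key w a haw, key w' b hbw, ← haw, ← hbw]
      exact h2 a ha b hb

theorem goodAt_prodVal {A B : Type*} [MetricSpace A] [MetricSpace B] {s : Set A} {t : Set B}
    (hs : IsOpen s) (ht : IsOpen t) (z : ↥s × ↥t) :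
    GoodAt (fun q : ↥s × ↥t => ((q.1 : A), (q.2 : B))) z :=
  GoodAt.of_isometry (isometry_subtype_coe.prodMap isometry_subtype_coe)
    (hs.isOpenMap_subtype_val.prodMap ht.isOpenMap_subtype_val) z

theorem goodAt_prodVal_left {A B : Type*} [MetricSpace A] [MetricSpace B] {s : Set A}
    (hs : IsOpen s) (z : ↥s × B) :
    GoodAt (fun q : ↥s × B => ((q.1 : A), q.2)) z :=
  GoodAt.of_isometry (isometry_subtype_coe.prodMap isometry_id)
    (hs.isOpenMap_subtype_val.prodMap IsOpenMap.id) z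

section Germs

variable {E X : Type u} [MetricSpace E] [MetricSpace X]

/-- `φ` is the germ at `u` of a product chart about the fiber over `x₀`. -/
def ChartGerm (p : E → X) (x₀ : X) (φ : X × ↥(p ⁻¹' {x₀}) → E) (u : ↥(p ⁻¹' {x₀})) : Prop :=
  GoodAt φ (x₀, u) ∧ ∀ᶠ z in 𝓝 (x₀, u), p (φ z) = z.1 ∧ (z.1 = x₀ → φ z = (z.2 : E))

theorem ChartGerm.eventually {p : E → X} {x₀ : X} {φ : X × ↥(p ⁻¹' {x₀}) → E}
    {u : ↥(p ⁻¹' {x₀})} (h : ChartGerm p x₀ φ u) : ∀ᶠ v in 𝓝 u, ChartGerm p x₀ φ v := by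
  have hc : ContinuousAt (fun v : ↥(p ⁻¹' {x₀}) => (x₀, v)) u := by fun_prop
  exact (hc.eventually h.1.eventually).and (hc.eventually h.2.eventually_nhds)

theorem ChartGerm.congr {p : E → X} {x₀ : X} {φ ψ : X × ↥(p ⁻¹' {x₀}) → E}
    {u : ↥(p ⁻¹' {x₀})} (h : ChartGerm p x₀ φ u) (e : φ =ᶠ[𝓝 (x₀, u)] ψ) :
    ChartGerm p x₀ ψ u := by
  refine ⟨h.1.congr e, ?_⟩
  filter_upwards [h.2, e] with z hz hz'
  rw [← hz']; exact hz

theorem ChartGerm.injOn {p : E → X} {x₀ : X} {φ : X × ↥(p ⁻¹' {x₀}) → E}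
    {C : Set ↥(p ⁻¹' {x₀})} (hC : IsCompact C) (h : ∀ u ∈ C, ChartGerm p x₀ φ u) :
    ∃ t ∈ 𝓝ˢ ({x₀} ×ˢ C), InjOn φ t := by
  refine Set.InjOn.exists_mem_nhdsSet ?_ (isCompact_singleton.prod hC) ?_ ?_
  · rintro ⟨x, u⟩ ⟨hx, hu⟩ ⟨y, v⟩ ⟨hy, hv⟩ e
    simp only [mem_singleton_iff] at hx hy
    subst hx; subst hy
    have e1 := ((h u hu).2.self_of_nhds).2 rfl
    have e2 := ((h v hv).2.self_of_nhds).2 rfl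
    rw [e1, e2] at e
    exact Prod.ext rfl (Subtype.ext e)
  · rintro ⟨x, u⟩ ⟨hx, hu⟩
    simp only [mem_singleton_iff] at hx
    subst hx
    exact (h u hu).1.continuousAt
  · rintro ⟨x, u⟩ ⟨hx, hu⟩
    simp only [mem_singleton_iff] at hx
    subst hx
    exact (h u hu).1.injOn

theorem exists_transition {p : E → X} {x₀ : X} [Nonempty ↥(p ⁻¹' {x₀})]
    {φ ψ : X × ↥(p ⁻¹' {x₀}) → E}
    {C : Set ↥(p ⁻¹' {x₀})} (hC : IsCompact C) (hφ : ∀ u ∈ C, ChartGerm p x₀ φ u)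
    (hψ : ∀ u ∈ C, ChartGerm p x₀ ψ u) :
    ∃ (H : X × ↥(p ⁻¹' {x₀}) → X × ↥(p ⁻¹' {x₀})) (N : Set X) (W : Set ↥(p ⁻¹' {x₀})),
      IsOpen N ∧ IsOpen W ∧ x₀ ∈ N ∧ C ⊆ W ∧ InjOn H (N ×ˢ W) ∧
      ∀ z ∈ N ×ˢ W, GoodAt H z ∧ (H z).1 = z.1 ∧ ψ (H z) = φ z ∧ (z.1 = x₀ → H z = z) := by
  classical
  have : Nonempty X := ⟨x₀⟩
  obtain ⟨tφ, htφ, iφ⟩ := ChartGerm.injOn hC hφ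
  obtain ⟨tψ, htψ, iψ⟩ := ChartGerm.injOn hC hψ
  have hmem : ∀ u ∈ C, (x₀, u) ∈ ({x₀} : Set X) ×ˢ C := fun u hu => ⟨rfl, hu⟩
  let V : Set (X × ↥(p ⁻¹' {x₀})) := {z | ∀ᶠ w in 𝓝 z, w ∈ tψ ∧ GoodAt ψ w ∧
    (p (ψ w) = w.1 ∧ (w.1 = x₀ → ψ w = (w.2 : E)))}
  have hVo : IsOpen V := isOpen_setOfPred_eventually_nhds
  have hV : ∀ z ∈ V, z ∈ tψ ∧ GoodAt ψ z ∧
    (p (ψ z) = z.1 ∧ (z.1 = x₀ → ψ z = (z.2 : E))) := fun z hz => hz.self_of_nhds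
  have hVi : InjOn ψ V := iψ.mono fun z hz => (hV z hz).1
  have hCV : ∀ u ∈ C, (x₀, u) ∈ V := fun u hu => by
    have := mem_nhdsSet_iff_forall.1 htψ _ (hmem u hu)
    filter_upwards [this, (hψ u hu).1.eventually, (hψ u hu).2] with w h1 h2 h3
    exact ⟨h1, h2, h3⟩
  let inv := Function.invFunOn ψ V
  have hinv : ∀ z ∈ V, inv (ψ z) = z := fun z hz => hVi.leftInvOn_invFunOn hz
  have hinvG : ∀ z ∈ V, GoodAt inv (ψ z) := fun z hz => by
    refine GoodAt.cancel_right (f := ψ) (hV z hz).2.1 ((GoodAt.id_good z).congr ?_)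
    filter_upwards [hVo.mem_nhds hz] with w hw
    exact (hinv w hw).symm
  let Ω : Set (X × ↥(p ⁻¹' {x₀})) := {z | ∀ᶠ w in 𝓝 z, w ∈ tφ ∧ GoodAt φ w ∧
    (p (φ w) = w.1 ∧ (w.1 = x₀ → φ w = (w.2 : E))) ∧ φ w ∈ ψ '' V ∧ w ∈ V}
  have hΩo : IsOpen Ω := isOpen_setOfPred_eventually_nhds
  have hΩ : {x₀} ×ˢ C ⊆ Ω := by
    rintro ⟨x, u⟩ ⟨hx, hu⟩
    simp only [mem_singleton_iff] at hx hu
    subst hx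
    have h0 := mem_nhdsSet_iff_forall.1 htφ _ (hmem u hu)
    have e1 := ((hφ u hu).2.self_of_nhds).2 rfl
    have e2 := ((hψ u hu).2.self_of_nhds).2 rfl
    have h4 : ψ '' V ∈ 𝓝 (φ (x, u)) := by
      rw [e1, ← e2, ← (hψ u hu).1.map_nhds]
      exact image_mem_map (hVo.mem_nhds (hCV u hu))
    filter_upwards [h0, (hφ u hu).1.eventually, (hφ u hu).2,
      (hφ u hu).1.continuousAt h4, hVo.mem_nhds (hCV u hu)] with w h1 h2 h3 h4 h5
    exact ⟨h1, h2, h3, h4, h5⟩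
  obtain ⟨N, W, hNo, hWo, hN, hW, hNW⟩ :=
    generalized_tube_lemma isCompact_singleton hC hΩo hΩ
  have hH : ∀ z ∈ N ×ˢ W, ψ (inv (φ z)) = φ z ∧ inv (φ z) ∈ V := by
    intro z hz
    obtain ⟨-, -, -, ⟨v, hv, hvz⟩, -⟩ := (hNW hz).self_of_nhds
    rw [← hvz, hinv v hv]
    exact ⟨rfl, hv⟩
  refine ⟨inv ∘ φ, N, W, hNo, hWo, hN rfl, hW, ?_, ?_⟩
  · intro a ha b hb hab
    have h1 := (hNW ha).self_of_nhds
    have h2 := (hNW hb).self_of_nhds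
    apply iφ h1.1 h2.1
    rw [← (hH a ha).1, ← (hH b hb).1]
    exact congrArg ψ hab
  · intro z hz
    obtain ⟨-, hg, hp, ⟨v, hv, hvz⟩, hzV⟩ := (hNW hz).self_of_nhds
    refine ⟨GoodAt.comp ?_ hg, ?_, (hH z hz).1, fun hzx => ?_⟩
    · rw [← hvz]; exact hinvG v hv
    · have h1 := (hV _ (hH z hz).2).2.2.1
      rw [(hH z hz).1, hp.1] at h1
      exact h1.symm
    · have h1 := hp.2 hzx
      have h2 := (hV z hzV).2.2.2 hzx
      change inv (φ z) = z
      rw [h1, ← h2, hinv z hzV]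

theorem exists_straighten {p : E → X} {x₀ : X} [Nonempty ↥(p ⁻¹' {x₀})]
    (hL : LipschitzDeformationPrincipleStar.{u} ↥(p ⁻¹' {x₀}))
    {φ ψ : X × ↥(p ⁻¹' {x₀}) → E}
    {C : Set ↥(p ⁻¹' {x₀})} (hC : IsCompact C) (hφ : ∀ u ∈ C, ChartGerm p x₀ φ u)
    (hψ : ∀ u ∈ C, ChartGerm p x₀ ψ u) :
    ∃ (Θ : X × ↥(p ⁻¹' {x₀}) → X × ↥(p ⁻¹' {x₀})), ∃ M ∈ 𝓝 x₀,
      (∀ u, GoodAt Θ (x₀, u)) ∧ (∀ z, z.1 ∈ M → (Θ z).1 = z.1) ∧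
      (∀ u, Θ (x₀, u) = (x₀, u)) ∧ ∀ t ∈ M, ∀ u ∈ C, ψ (Θ (t, u)) = φ (t, u) := by
  classical
  obtain ⟨H, N, W, hNo, hWo, hxN, hCW, hHi, hH⟩ := exists_transition hC hφ hψ
  obtain ⟨𝒩, h𝒩, D, ⟨-, hDid, hD⟩, hP⟩ := hL W hWo C hC hCW
  have hHc : Continuous (fun q : ↥N × ↥W => (H ((q.1 : X), (q.2 : ↥(p ⁻¹' {x₀})))).2) := by
    rw [continuous_iff_continuousAt]
    intro q
    have h1 : ContinuousAt (fun q : ↥N × ↥W => ((q.1 : X), (q.2 : ↥(p ⁻¹' {x₀})))) q := by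
      fun_prop
    exact (ContinuousAt.comp (f := fun q : ↥N × ↥W => ((q.1 : X), (q.2 : ↥(p ⁻¹' {x₀}))))
      (hH _ ⟨q.1.2, q.2.2⟩).1.continuousAt h1).snd
  let k : C(↥N, C(↥W, ↥(p ⁻¹' {x₀}))) := ContinuousMap.curry ⟨_, hHc⟩
  have hk : ∀ (t : ↥N) (u : ↥W), k t u = (H ((t : X), (u : ↥(p ⁻¹' {x₀})))).2 :=
    fun _ _ => rfl
  have hk0 : k ⟨x₀, hxN⟩ = inclCM W := by
    ext1 u
    rw [hk, (hH (x₀, (u : ↥(p ⁻¹' {x₀}))) ⟨hxN, u.2⟩).2.2.2 rfl]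
    rfl
  have hk𝒩 : k ⁻¹' 𝒩 ∈ 𝓝 (⟨x₀, hxN⟩ : ↥N) := k.continuous.continuousAt (by rw [hk0]; exact h𝒩)
  obtain ⟨M₁, hM₁, hM₁o, hxM₁⟩ := _root_.mem_nhds_iff.1 hk𝒩
  let M : Set X := Subtype.val '' M₁
  have hMo : IsOpen M := hNo.isOpenMap_subtype_val _ hM₁o
  have hxM : x₀ ∈ M := ⟨_, hxM₁, rfl⟩
  have hMN : ∀ t ∈ M, t ∈ N := by rintro _ ⟨t, _, rfl⟩; exact t.2
  have hM𝒩 : ∀ (t : X) (ht : t ∈ M), k ⟨t, hMN t ht⟩ ∈ 𝒩 := by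
    rintro _ ⟨t, ht, rfl⟩; exact hM₁ ht
  let h : ↥M → C(↥W, ↥(p ⁻¹' {x₀})) := fun t => k ⟨t, hMN t t.2⟩
  have hh : ∀ (t : ↥M) (u : ↥W), h t u = (H ((t : X), (u : ↥(p ⁻¹' {x₀})))).2 :=
    fun _ _ => rfl
  have hHpair : ∀ (t : ↥M) (u : ↥W), H ((t : X), (u : ↥(p ⁻¹' {x₀}))) = ((t : X), h t u) :=
    fun t u => Prod.ext (hH _ ⟨hMN t t.2, u.2⟩).2.1 rfl
  have hemb : ∀ t, h t ∈ 𝒩 ∧ IsOpenLipschitzEmbedding (⇑(h t) : ↥W → ↥(p ⁻¹' {x₀})) := by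
    intro t
    refine ⟨hM𝒩 t t.2, isOpenLipschitzEmbedding_of_goodAt ?_ ?_⟩
    · intro u v huv
      have h1 : ((t : X), (u : ↥(p ⁻¹' {x₀}))) = ((t : X), (v : ↥(p ⁻¹' {x₀}))) := by
        apply hHi ⟨hMN t t.2, u.2⟩ ⟨hMN t t.2, v.2⟩
        rw [hHpair, hHpair, huv]
      exact Subtype.ext (Prod.ext_iff.1 h1).2
    · intro u
      have h1 : GoodAt (fun v => (H ((t : X), v)).2) (u : ↥(p ⁻¹' {x₀})) := by
        apply GoodAt.slice (hH _ ⟨hMN t t.2, u.2⟩).1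
        filter_upwards [(hNo.prod hWo).mem_nhds
          (show ((t : X), (u : ↥(p ⁻¹' {x₀}))) ∈ N ×ˢ W from ⟨hMN t t.2, u.2⟩)] with z hz
        exact (hH z hz).2.1
      exact GoodAt.comp (f := fun u : ↥W => (u : ↥(p ⁻¹' {x₀}))) h1
        (GoodAt.of_isometry isometry_subtype_coe hWo.isOpenMap_subtype_val u)
  have hGc : Continuous (fun q : ↥M × ↥W => (q.1, h q.1 q.2)) := by
    refine continuous_fst.prodMk ?_
    have h1 : Continuous (fun q : ↥M × ↥W => ((⟨q.1, hMN _ q.1.2⟩ : ↥N), q.2)) := by fun_prop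
    exact hHc.comp h1
  have hGi : Function.Injective (fun q : ↥M × ↥W => (q.1, h q.1 q.2)) := by
    rintro ⟨t, u⟩ ⟨t', v⟩ e
    simp only [Prod.mk.injEq] at e
    obtain ⟨rfl, e⟩ := e
    rw [(hemb t).2.1.1 e]
  have hGg : ∀ q, GoodAt (fun q : ↥M × ↥W => (q.1, h q.1 q.2)) q := by
    intro q
    refine GoodAt.cancel_left
      (g := fun q : ↥M × ↥(p ⁻¹' {x₀}) => ((q.1 : X), q.2)) hGc (goodAt_prodVal_left hMo _) ?_
    have h1 := GoodAt.comp (f := fun q : ↥M × ↥W => ((q.1 : X), (q.2 : ↥(p ⁻¹' {x₀})))) (g := H)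
      (z := q) (hH _ ⟨hMN _ q.1.2, q.2.2⟩).1 (goodAt_prodVal hMo hWo q)
    refine h1.congr (Eventually.of_forall fun w => ?_)
    exact hHpair w.1 w.2
  have hiso := hP ↥M h hemb ⟨isOpenEmbedding_of_goodAt hGi hGg, fun _ => rfl,
    (isOpenLipschitzEmbedding_of_goodAt hGi hGg).1⟩
  have hisoG : ∀ q, GoodAt (fun q : ↥M × ↥(p ⁻¹' {x₀}) => (q.1, D (h q.1) q.2)) q := fun q =>
    IsOpenLipschitzEmbedding.goodAt ⟨hiso.2.2, hiso.1.isOpen_range⟩ q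
  let Θ : X × ↥(p ⁻¹' {x₀}) → X × ↥(p ⁻¹' {x₀}) := fun z =>
    if hz : z.1 ∈ M then (z.1, D (h ⟨z.1, hz⟩) z.2) else z
  have hΘ : ∀ (t : X) (ht : t ∈ M) (u), Θ (t, u) = (t, D (h ⟨t, ht⟩) u) :=
    fun t ht u => dif_pos ht
  refine ⟨Θ, M, hMo.mem_nhds hxM, fun u => ?_, fun z hz => ?_, fun u => ?_, fun t ht u hu => ?_⟩
  · refine GoodAt.cancel_right (f := fun q : ↥M × ↥(p ⁻¹' {x₀}) => ((q.1 : X), q.2))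
      (z := (⟨x₀, hxM⟩, u)) (goodAt_prodVal_left hMo _) ?_
    have h1 := GoodAt.comp (g := fun q : ↥M × ↥(p ⁻¹' {x₀}) => ((q.1 : X), q.2))
      (z := (⟨x₀, hxM⟩, u)) (goodAt_prodVal_left hMo _) (hisoG _)
    refine h1.congr (Eventually.of_forall fun w => ?_)
    exact (hΘ w.1 w.1.2 w.2).symm
  · rw [← Prod.mk.eta (p := z), hΘ z.1 hz]
  · rw [hΘ x₀ hxM]
    have : h ⟨x₀, hxM⟩ = inclCM W := hk0
    rw [this, hDid]; rfl
  · rw [hΘ t ht]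
    have h1 := (hD _ (hemb ⟨t, ht⟩).1 (hemb ⟨t, ht⟩).2).2.1 ⟨u, hCW hu⟩ hu
    rw [h1]
    have h2 := hHpair ⟨t, ht⟩ ⟨u, hCW hu⟩
    simp only at h2
    rw [← h2]
    exact (hH _ ⟨hMN t ht, hCW hu⟩).2.2.1

theorem exists_union {p : E → X} {x₀ : X} [CompactSpace ↥(p ⁻¹' {x₀})]
    [Nonempty ↥(p ⁻¹' {x₀})]
    (hL : LipschitzDeformationPrincipleStar.{u} ↥(p ⁻¹' {x₀}))
    {φ ψ : X × ↥(p ⁻¹' {x₀}) → E}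
    {A B : Set ↥(p ⁻¹' {x₀})} (hA : IsClosed A) (hB : IsClosed B)
    (hφ : ∀ u ∈ A, ChartGerm p x₀ φ u) (hψ : ∀ u ∈ B, ChartGerm p x₀ ψ u) :
    ∃ χ : X × ↥(p ⁻¹' {x₀}) → E, ∀ u ∈ A ∪ B, ChartGerm p x₀ χ u := by
  classical
  have hop : ∀ φ : X × ↥(p ⁻¹' {x₀}) → E, IsOpen {u | ChartGerm p x₀ φ u} := fun φ =>
    isOpen_iff_mem_nhds.2 fun u hu => ChartGerm.eventually hu
  obtain ⟨A', hA'c, hAA', hA'⟩ := exists_compact_between hA.isCompact (hop φ) hφ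
  obtain ⟨B', hB'c, hBB', hB'⟩ := exists_compact_between hB.isCompact (hop ψ) hψ
  obtain ⟨Θ, M, hM, hΘg, hΘ1, hΘ0, hΘC⟩ := exists_straighten hL (hA'c.inter hB'c)
    (fun u hu => hA' hu.1) (fun u hu => hB' hu.2)
  let χ : X × ↥(p ⁻¹' {x₀}) → E := fun z => if z.2 ∈ A' then φ z else ψ (Θ z)
  refine ⟨χ, fun u hu => ?_⟩
  rcases hu with hu | hu
  · refine ChartGerm.congr (hA' (interior_subset (hAA' hu))) ?_
    have : ∀ᶠ z : X × ↥(p ⁻¹' {x₀}) in 𝓝 (x₀, u), z.2 ∈ interior A' :=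
      continuous_snd.continuousAt (isOpen_interior.mem_nhds (hAA' hu))
    filter_upwards [this] with z hz
    exact (if_pos (interior_subset hz)).symm
  · have h1 : ChartGerm p x₀ ψ u := hψ u hu
    have hMz : ∀ᶠ z : X × ↥(p ⁻¹' {x₀}) in 𝓝 (x₀, u), z.1 ∈ M :=
      continuous_fst.continuousAt hM
    have h2 : ChartGerm p x₀ (ψ ∘ Θ) u := by
      refine ⟨GoodAt.comp (by rw [hΘ0]; exact h1.1) (hΘg u), ?_⟩
      have hc := (hΘg u).continuousAt
      have h3 := h1.2
      rw [← hΘ0 u] at h3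
      filter_upwards [hc.eventually h3, hMz] with z hz hzM
      refine ⟨hz.1.trans (hΘ1 z hzM), fun hzx => ?_⟩
      have h4 := hz.2 ((hΘ1 z hzM).trans hzx)
      obtain ⟨t, v⟩ := z
      simp only at hzx
      subst hzx
      rw [hΘ0] at h4
      simpa [hΘ0] using h4
    refine h2.congr ?_
    have : ∀ᶠ z : X × ↥(p ⁻¹' {x₀}) in 𝓝 (x₀, u), z.2 ∈ interior B' :=
      continuous_snd.continuousAt (isOpen_interior.mem_nhds (hBB' hu))
    filter_upwards [this, hMz] with z hz hzM
    by_cases hzA : z.2 ∈ A'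
    · have : χ z = φ z := if_pos hzA
      rw [this]
      exact hΘC z.1 hzM z.2 ⟨hzA, interior_subset hz⟩
    · exact (if_neg hzA).symm

theorem exists_local {p : E → X} (hp : IsLipschitzSubmersion p) {x₀ : X}
    (u : ↥(p ⁻¹' {x₀})) : ∃ φ : X × ↥(p ⁻¹' {x₀}) → E, ChartGerm p x₀ φ u := by
  classical
  obtain ⟨y, hy⟩ := u
  change p y = x₀ at hy
  subst hy
  obtain ⟨U, N, f, hU, hyU, hN, ⟨hf, hf1, hf2⟩, -⟩ := hp.2 y
  let φ : X × ↥(p ⁻¹' {p y}) → E := fun z =>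
    if h : z.2 ∈ U ∧ z.1 ∈ N then f (⟨z.2, h.1⟩, ⟨z.1, h.2⟩) else y
  have hφ : ∀ (z : X × ↥(p ⁻¹' {p y})) (h1 : z.2 ∈ U) (h2 : z.1 ∈ N),
      φ z = f (⟨z.2, h1⟩, ⟨z.1, h2⟩) := fun z h1 h2 => dif_pos ⟨h1, h2⟩
  have hpy : p y ∈ interior N := mem_interior_iff_mem_nhds.2 hN
  refine ⟨φ, ?_, ?_⟩
  · refine GoodAt.cancel_right
      (f := fun q : ↥(interior N) × ↥U => ((q.1 : X), (q.2 : ↥(p ⁻¹' {p y}))))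
      (z := (⟨p y, hpy⟩, ⟨⟨y, rfl⟩, hyU⟩)) (goodAt_prodVal isOpen_interior hU _) ?_
    let j : ↥(interior N) × ↥U → ↥U × ↥N := fun q => (q.2, ⟨q.1, interior_subset q.1.2⟩)
    have hj : Isometry j := by
      intro a b
      simp only [j, Prod.edist_eq, Subtype.edist_eq]
      exact max_comm _ _
    have hjo : IsOpenMap j := by
      have h1 : IsOpenMap (Set.inclusion (interior_subset (s := N))) :=
        isOpen_interior.isOpenMap_inclusion _
      exact (IsOpenMap.id.prodMap h1).comp (Homeomorph.prodComm _ _).isOpenMap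
    refine (GoodAt.comp (hf.goodAt _) (GoodAt.of_isometry hj hjo _)).congr
      (Eventually.of_forall fun w => ?_)
    exact (hφ ((w.1 : X), (w.2 : ↥(p ⁻¹' {p y}))) w.2.2
      (interior_subset (s := N) w.1.2)).symm
  · have h1 : ∀ᶠ z : X × ↥(p ⁻¹' {p y}) in 𝓝 (p y, ⟨y, rfl⟩), z.1 ∈ N :=
      continuous_fst.continuousAt hN
    have h2 : ∀ᶠ z : X × ↥(p ⁻¹' {p y}) in 𝓝 (p y, ⟨y, rfl⟩), z.2 ∈ U :=
      continuous_snd.continuousAt (hU.mem_nhds hyU)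
    filter_upwards [h1, h2] with z hz1 hz2
    rw [hφ z hz2 hz1]
    refine ⟨hf1 _, fun hz => ?_⟩
    obtain ⟨t, v⟩ := z
    simp only at hz
    subst hz
    exact hf2 _ _

theorem exists_global {p : E → X} (hp : IsLipschitzSubmersion p) {x₀ : X}
    [CompactSpace ↥(p ⁻¹' {x₀})]
    (hL : LipschitzDeformationPrincipleStar.{u} ↥(p ⁻¹' {x₀})) (hE : Nonempty E) :
    ∃ φ : X × ↥(p ⁻¹' {x₀}) → E, ∀ u, ChartGerm p x₀ φ u := by
  rcases isEmpty_or_nonempty ↥(p ⁻¹' {x₀}) with h | h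
  · exact ⟨fun _ => hE.some, fun u => h.elim u⟩
  have key : ∃ φ : X × ↥(p ⁻¹' {x₀}) → E, ∀ u ∈ closure (univ : Set ↥(p ⁻¹' {x₀})),
      ChartGerm p x₀ φ u := by
    refine IsCompact.induction_on (isCompact_univ (X := ↥(p ⁻¹' {x₀})))
      (p := fun s => ∃ φ : X × ↥(p ⁻¹' {x₀}) → E, ∀ u ∈ closure s, ChartGerm p x₀ φ u)
      ?_ ?_ ?_ ?_
    · exact ⟨fun _ => hE.some, fun u hu => by simp at hu⟩
    · rintro s t hst ⟨φ, hφ⟩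
      exact ⟨φ, fun u hu => hφ u (closure_mono hst hu)⟩
    · rintro s t ⟨φ, hφ⟩ ⟨ψ, hψ⟩
      rw [closure_union]
      exact exists_union hL isClosed_closure isClosed_closure hφ hψ
    · intro u _
      obtain ⟨φ, hφ⟩ := exists_local hp u
      obtain ⟨t, ht, htc, hts⟩ := exists_mem_nhds_isClosed_subset hφ.eventually
      refine ⟨t, mem_nhdsWithin_of_mem_nhds ht, φ, fun v hv => ?_⟩
      rw [htc.closure_eq] at hv
      exact hts hv
  obtain ⟨φ, hφ⟩ := key
  exact ⟨φ, fun u => hφ u (subset_closure (mem_univ u))⟩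

end Germs

end Helpers

/-- **Lipschitz fibration theorem, global form** (second part of Theorem 1.2).  A proper
Lipschitz submersion `p : E → X` over a locally compact, locally connected space, all of whose
fibers are locally connected and satisfy `L*`, is a locally trivial Lipschitz fiber bundle:
every `x ∈ X` has a neighbourhood `N'` and a Lipschitz product chart
`h : p ⁻¹ x × N' → E` about the whole fiber `p ⁻¹ x`, with image `p ⁻¹ N'`. -/
theorem lipschitz_submersion_bundle
    {E X : Type u} [MetricSpace E] [MetricSpace X]
    [LocallyCompactSpace X] [LocallyConnectedSpace X]
    (p : E → X) (hp : IsLipschitzSubmersion p)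
    (hproper : ∀ K : Set X, IsCompact K → IsCompact (p ⁻¹' K))
    (hfib : ∀ x : X, LocallyConnectedSpace ↥(p ⁻¹' {x}) ∧
      LipschitzDeformationPrincipleStar.{u} ↥(p ⁻¹' {x})) :
    ∀ x : X, ∃ N' ∈ 𝓝 x, ∃ h : ↥(Set.univ : Set ↥(p ⁻¹' {x})) × ↥N' → E,
      IsLipschitzProductChart p x Set.univ N' h ∧ Set.range h = p ⁻¹' N' := by
  intro x
  have hFc : CompactSpace ↥(p ⁻¹' {x}) := isCompact_iff_compactSpace.1 (hproper _ isCompact_singleton)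
  rcases isEmpty_or_nonempty E with hE | hE
  · refine ⟨univ, Filter.univ_mem, fun z => (hE.elim (z.1.1 : E)), ⟨?_, ?_, ?_⟩, ?_⟩
    · exact isOpenLipschitzEmbedding_of_goodAt (fun z => hE.elim (z.1.1 : E))
        (fun z => hE.elim (z.1.1 : E))
    · exact fun z => hE.elim (z.1.1 : E)
    · exact fun u => hE.elim (u.1 : E)
    · ext e; exact hE.elim e
  obtain ⟨φ, hφ⟩ := exists_global hp (hfib x).2 hE
  obtain ⟨t, ht, hti⟩ := ChartGerm.injOn isCompact_univ (fun u _ => hφ u)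
  let Ω : Set (X × ↥(p ⁻¹' {x})) := {z | ∀ᶠ w in 𝓝 z, w ∈ t ∧ GoodAt φ w ∧
    (p (φ w) = w.1 ∧ (w.1 = x → φ w = (w.2 : E)))}
  have hΩo : IsOpen Ω := isOpen_setOfPred_eventually_nhds
  have hΩ : {x} ×ˢ univ ⊆ Ω := by
    rintro ⟨x', u⟩ ⟨hx, hu⟩
    simp only [mem_singleton_iff] at hx
    subst hx
    have h0 := mem_nhdsSet_iff_forall.1 ht (x', u) ⟨rfl, hu⟩
    filter_upwards [h0, (hφ u).1.eventually, (hφ u).2] with w h1 h2 h3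
    exact ⟨h1, h2, h3⟩
  obtain ⟨N, W, hNo, hWo, hxN, hW, hNW⟩ :=
    generalized_tube_lemma isCompact_singleton isCompact_univ hΩo hΩ
  have hN : ∀ z : X × ↥(p ⁻¹' {x}), z.1 ∈ N → z ∈ t ∧ GoodAt φ z ∧
      (p (φ z) = z.1 ∧ (z.1 = x → φ z = (z.2 : E))) := fun z hz =>
    (hNW ⟨hz, hW (mem_univ z.2)⟩ : z ∈ Ω).self_of_nhds
  -- the image is an open neighbourhood of the fiber
  have hIo : IsOpen (φ '' (N ×ˢ univ)) := by
    rw [isOpen_iff_mem_nhds]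
    rintro _ ⟨z, hz, rfl⟩
    rw [← (hN z hz.1).2.1.map_nhds]
    exact Filter.image_mem_map ((hNo.prod isOpen_univ).mem_nhds hz)
  obtain ⟨K, hK, hKx⟩ := exists_compact_mem_nhds x
  have hcl : IsClosed (p '' (p ⁻¹' K \ φ '' (N ×ˢ univ))) :=
    (((hproper K hK).diff hIo).image hp.1.continuous).isClosed
  have hxcl : x ∉ p '' (p ⁻¹' K \ φ '' (N ×ˢ univ)) := by
    rintro ⟨e, ⟨_, he⟩, hex⟩
    apply he
    refine ⟨(x, ⟨e, hex⟩), ⟨hxN rfl, mem_univ _⟩, ?_⟩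
    exact (hN (x, ⟨e, hex⟩) (hxN rfl)).2.2.2 rfl
  let M : Set X := N ∩ interior K ∩ (p '' (p ⁻¹' K \ φ '' (N ×ˢ univ)))ᶜ
  have hMo : IsOpen M := (hNo.inter isOpen_interior).inter hcl.isOpen_compl
  have hxM : x ∈ M := ⟨⟨hxN rfl, mem_interior_iff_mem_nhds.2 hKx⟩, hxcl⟩
  have hMN : ∀ s ∈ M, s ∈ N := fun s hs => hs.1.1
  refine ⟨M, hMo.mem_nhds hxM, fun z => φ ((z.2 : X), (z.1 : ↥(p ⁻¹' {x}))), ⟨?_, ?_, ?_⟩, ?_⟩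
  · refine isOpenLipschitzEmbedding_of_goodAt ?_ ?_
    · rintro ⟨u, s⟩ ⟨v, s'⟩ e
      have h1 := hti (hN ((s : X), (u : ↥(p ⁻¹' {x}))) (hMN _ s.2)).1
        (hN ((s' : X), (v : ↥(p ⁻¹' {x}))) (hMN _ s'.2)).1 e
      simp only [Prod.mk.injEq] at h1
      exact Prod.ext (Subtype.ext h1.2) (Subtype.ext h1.1)
    · intro z
      have h1 : GoodAt (Prod.swap : ↥(univ : Set ↥(p ⁻¹' {x})) × ↥M → _) z := by
        refine GoodAt.of_isometry ?_ (Homeomorph.prodComm _ _).isOpenMap z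
        intro a b
        simp only [Prod.edist_eq, Prod.fst_swap, Prod.snd_swap]
        exact max_comm _ _
      have h2 := GoodAt.comp (goodAt_prodVal hMo isOpen_univ (Prod.swap z)) h1
      exact GoodAt.comp (f := (fun q : ↥M × ↥(univ : Set ↥(p ⁻¹' {x})) =>
        ((q.1 : X), (q.2 : ↥(p ⁻¹' {x})))) ∘ Prod.swap) (hN _ (hMN _ z.2.2)).2.1 h2
  · intro z
    exact (hN _ (hMN _ z.2.2)).2.2.1
  · intro u hb
    exact (hN (x, (u : ↥(p ⁻¹' {x}))) (hMN _ hb)).2.2.2 rfl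
  · ext e
    constructor
    · rintro ⟨z, rfl⟩
      have h1 := (hN ((z.2 : X), (z.1 : ↥(p ⁻¹' {x}))) (hMN _ z.2.2)).2.2.1
      change p (φ _) ∈ M
      rw [h1]
      exact z.2.2
    · intro he
      have he' : p e ∈ M := he
      have h1 : e ∈ φ '' (N ×ˢ univ) := by
        by_contra hne
        exact he'.2 ⟨e, ⟨interior_subset (s := K) he'.1.2, hne⟩, rfl⟩
      obtain ⟨z, hz, hze⟩ := h1
      have h2 : p e = z.1 := by rw [← hze]; exact (hN z hz.1).2.2.1
      exact ⟨(⟨z.2, mem_univ _⟩, ⟨z.1, h2 ▸ he'⟩), hze⟩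
end

section
/- Let h : F → F′ be an open embedding between locally compact, locally connected Hausdorff spaces and let C be a compact subset of F. Then: (i) there is a neighborhood N of h in the compact-open topology on continuous maps F → F′ such that every open embedding g ∈ N satisfies h(C) ⊆ g(F); and (ii) there is a neighborhood N′ of h in the compact-open topology such that every open embedding g ∈ N′ with g = h outside C satisfies g(F) = h(F). -/
open Topology Set

universe u v

/-- Openness-of-image stability for open embeddings between locally compact, locally connected
Hausdorff spaces (Proposition 2.2): if `g` is an open embedding sufficiently close (in the
compact-open topology) to an open embedding `h`, then `h(C) ⊆ g(F)` for a given compactum `C`;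
and if moreover `g = h` outside `C`, then `g(F) = h(F)`. -/
theorem openEmbedding_image_stability
    {F : Type u} {F' : Type v} [TopologicalSpace F] [TopologicalSpace F']
    [LocallyCompactSpace F] [LocallyConnectedSpace F] [T2Space F]
    [LocallyCompactSpace F'] [LocallyConnectedSpace F'] [T2Space F']
    (h : C(F, F')) (hh : IsOpenEmbedding (⇑h)) (C : Set F) (hC : IsCompact C) :
    (∃ N ∈ 𝓝 h, ∀ g : C(F, F'), g ∈ N → IsOpenEmbedding (⇑g) →
      ⇑h '' C ⊆ Set.range (⇑g)) ∧
    (∃ N' ∈ 𝓝 h, ∀ g : C(F, F'), g ∈ N' → IsOpenEmbedding (⇑g) →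
      (∀ x ∉ C, g x = h x) → Set.range (⇑g) = Set.range (⇑h)) := by
  have key : ∀ x : F, ∃ V : Set F', IsOpen V ∧ h x ∈ V ∧ ∃ N ∈ 𝓝 h, ∀ g : C(F, F'), g ∈ N →
      IsOpenEmbedding (⇑g) → V ⊆ Set.range (⇑g) := by
    intro x
    obtain ⟨K, hK, hxK⟩ := exists_compact_mem_nhds x
    have hO : IsOpen (⇑h '' interior K) := hh.isOpenMap _ isOpen_interior
    have hxO : h x ∈ ⇑h '' interior K := ⟨x, mem_interior_iff_mem_nhds.2 hxK, rfl⟩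
    obtain ⟨T, hT, hTc, hTO⟩ := exists_mem_nhds_isClosed_subset (hO.mem_nhds hxO)
    obtain ⟨V, hVT, hVo, hxV, hVc⟩ :=
      locallyConnectedSpace_iff_subsets_isOpen_isConnected.1 inferInstance (h x) T hT
    have hD : IsCompact (K \ interior K) := hK.diff isOpen_interior
    refine ⟨V, hVo, hxV, {g | MapsTo g (K \ interior K) Tᶜ} ∩ {g | MapsTo g {x} V},
      Filter.inter_mem ?_ ?_, ?_⟩
    · refine (ContinuousMap.isOpen_setOf_mapsTo hD hTc.isOpen_compl).mem_nhds ?_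
      intro y hy hyT
      obtain ⟨z, hz, hzy⟩ := hTO hyT
      exact hy.2 (hh.injective hzy ▸ hz)
    · refine (ContinuousMap.isOpen_setOf_mapsTo isCompact_singleton hVo).mem_nhds ?_
      rintro y rfl
      exact hxV
    · rintro g ⟨hg1, hg2⟩ hg
      have hA : IsOpen (⇑g '' interior K) := hg.isOpenMap _ isOpen_interior
      have hB : IsOpen (⇑g '' K)ᶜ := (hK.image g.continuous).isClosed.isOpen_compl
      have hsub : V ⊆ ⇑g '' interior K := by
        refine hVc.isPreconnected.subset_left_of_subset_union hA hB ?_ ?_ ?_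
        · rw [Set.disjoint_left]
          rintro _ ⟨y, hy, rfl⟩ hn
          exact hn ⟨y, interior_subset hy, rfl⟩
        · intro y hy
          by_cases hyK : y ∈ ⇑g '' K
          · obtain ⟨z, hz, rfl⟩ := hyK
            by_cases hzi : z ∈ interior K
            · exact Or.inl ⟨z, hzi, rfl⟩
            · exact absurd (hVT hy) (hg1 ⟨hz, hzi⟩)
          · exact Or.inr hyK
        · exact ⟨g x, hg2 rfl, x, mem_interior_iff_mem_nhds.2 hxK, rfl⟩
      exact hsub.trans (Set.image_subset_range _ _)
  have part1 : ∃ N ∈ 𝓝 h, ∀ g : C(F, F'), g ∈ N → IsOpenEmbedding (⇑g) →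
      ⇑h '' C ⊆ Set.range (⇑g) := by
    choose V hVo hxV N hN hNg using key
    obtain ⟨t, -, ht⟩ := hC.elim_nhds_subcover (fun x => ⇑h ⁻¹' V x)
      (fun x _ => ((hVo x).preimage h.continuous).mem_nhds (hxV x))
    refine ⟨⋂ x ∈ t, N x, (Filter.biInter_finset_mem t).2 fun x _ => hN x, ?_⟩
    rintro g hgN hg _ ⟨y, hy, rfl⟩
    obtain ⟨x, hx, hyx⟩ := Set.mem_iUnion₂.1 (ht hy)
    exact hNg x g (Set.mem_iInter₂.1 hgN x hx) hg hyx
  refine ⟨part1, ?_⟩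
  obtain ⟨N, hN, hNg⟩ := part1
  refine ⟨N ∩ {g | MapsTo g C (Set.range h)}, Filter.inter_mem hN
    ((ContinuousMap.isOpen_setOf_mapsTo hC hh.isOpen_range).mem_nhds fun y _ => ⟨y, rfl⟩), ?_⟩
  rintro g ⟨hg1, hg2⟩ hg heq
  apply Set.Subset.antisymm
  · rintro _ ⟨y, rfl⟩
    by_cases hy : y ∈ C
    · exact hg2 hy
    · exact ⟨y, (heq y hy).symm⟩
  · rintro _ ⟨y, rfl⟩
    by_cases hy : y ∈ C
    · exact hNg g hg1 hg ⟨y, hy, rfl⟩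
    · exact ⟨y, heq y hy⟩
end

section
/- Let X be a locally compact, locally connected metric space. Then the Lipschitz deformation principle L(X) holds if and only if the following holds: for every open U ⊆ X and all compacta C ⊆ C′ ⊆ U with C′ a neighborhood of C, there exist a neighborhood N of the inclusion i : U → X in the compact-open topology and a continuous rule h ↦ h′ defined on the open Lipschitz embeddings h : U → X lying in N, assigning to each such h a Lipschitz isomorphism h′ : X → X with h′ = h on C and h′ = i outside C′, and sending the inclusion to the identity of X. -/
open Topology Metric Set

universe u v

/-- The variant of the Lipschitz deformation principle in which the deformed embedding is the
inclusion outside a prescribed compact neighbourhood `C'` of `C`. -/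
def LipschitzDeformationPrinciple' (X : Type v) [MetricSpace X] : Prop :=
  ∀ U : Set X, IsOpen U → ∀ C C' : Set X, IsCompact C → IsCompact C' →
    C ⊆ interior C' → C' ⊆ U →
    ∃ N ∈ 𝓝 (inclCM U), ∃ D : C(↥U, X) → C(X, X),
      ContinuousOn D {h | h ∈ N ∧ IsOpenLipschitzEmbedding (⇑h : ↥U → X)} ∧
      D (inclCM U) = ContinuousMap.id X ∧
      ∀ h ∈ N, IsOpenLipschitzEmbedding (⇑h : ↥U → X) →
        IsLipschitzIso (⇑(D h) : X → X) ∧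
        (∀ x : ↥U, (x : X) ∈ C → D h x = h x) ∧
        (∀ x : X, x ∉ C' → D h x = x)

theorem IsOpenLipschitzEmbedding.restrict_aux {X : Type*} [MetricSpace X] {U V : Set X}
    (hV : IsOpen V) (hVU : V ⊆ U) {h : ↥U → X} (hh : IsOpenLipschitzEmbedding h) :
    IsOpenLipschitzEmbedding (h ∘ Set.inclusion hVU) := by
  obtain ⟨⟨hinj, hlip, g, hg, hgl⟩, hopen⟩ := hh
  have hg' : ∀ x : ↥U, g ⟨h x, mem_range_self x⟩ = x := fun x => hg x
  have hsub : ∀ y : Set.range (h ∘ Set.inclusion hVU), (y : X) ∈ Set.range h := by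
    rintro ⟨_, x, rfl⟩
    exact ⟨_, rfl⟩
  have hmem : ∀ y : Set.range (h ∘ Set.inclusion hVU), (g ⟨y, hsub y⟩ : X) ∈ V := by
    rintro ⟨_, x, rfl⟩
    have := hg' (Set.inclusion hVU x)
    simp only [Function.comp_apply, this]
    exact x.2
  refine ⟨⟨hinj.comp (Set.inclusion_injective hVU), ?_, fun y => ⟨g ⟨y, hsub y⟩, hmem y⟩, ?_, ?_⟩, ?_⟩
  · refine hlip.comp (LipschitzWith.locallyLipschitz (K := 1) ?_)
    exact LipschitzWith.of_dist_le_mul fun x y => by simp [Subtype.dist_eq]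
  · intro x
    have := congrArg (Subtype.val : ↥U → X) (hg' (Set.inclusion hVU x))
    exact Subtype.ext this
  · have hi : LocallyLipschitz
        (fun y : Set.range (h ∘ Set.inclusion hVU) => (⟨y, hsub y⟩ : Set.range h)) :=
      LipschitzWith.locallyLipschitz (K := 1)
        (LipschitzWith.of_dist_le_mul fun x y => by simp [Subtype.dist_eq])
    exact hgl.comp hi
  · have : Set.range (h ∘ Set.inclusion hVU) =
        Subtype.val '' {y : Set.range h | (g y : X) ∈ V} := by
      ext y
      constructor
      · intro hy
        exact ⟨⟨y, hsub ⟨y, hy⟩⟩, hmem ⟨y, hy⟩, rfl⟩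
      · rintro ⟨⟨_, x, rfl⟩, hx, rfl⟩
        have hx' : (g ⟨h x, mem_range_self x⟩ : X) ∈ V := hx
        rw [hg' x] at hx'
        exact ⟨⟨x, hx'⟩, rfl⟩
    rw [this]
    exact hopen.isOpenMap_subtype_val _
      (hV.preimage (continuous_subtype_val.comp hgl.continuous))

/-- Remark 2.8: for a locally compact, locally connected metric space, the principle `L(X)`
is equivalent to its variant in which the deformation is supported in a prescribed compact
neighbourhood `C'` of `C`. -/
theorem lipschitzDeformationPrinciple_iff_rel
    (X : Type v) [MetricSpace X] [LocallyCompactSpace X] [LocallyConnectedSpace X] :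
    LipschitzDeformationPrinciple X ↔ LipschitzDeformationPrinciple' X := by
  constructor
  · intro H U hU C C' hC hC' hCC' hC'U
    have hVU : interior C' ⊆ U := interior_subset.trans hC'U
    obtain ⟨N, hN, D, hD, hDi, hDh⟩ := H (interior C') isOpen_interior C hC hCC'
    let R : C(↥U, X) → C(↥(interior C'), X) :=
      fun h => h.comp ⟨Set.inclusion hVU, continuous_inclusion hVU⟩
    have hR : Continuous R := ContinuousMap.continuous_precomp _
    have hRi : R (inclCM U) = inclCM (interior C') := rfl
    have hRe : ∀ h : C(↥U, X), IsOpenLipschitzEmbedding (⇑h : ↥U → X) →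
        IsOpenLipschitzEmbedding (⇑(R h) : ↥(interior C') → X) :=
      fun h hh => hh.restrict_aux isOpen_interior hVU
    refine ⟨R ⁻¹' N, hR.continuousAt.preimage_mem_nhds (by rw [hRi]; exact hN),
      fun h => D (R h), ?_, ?_, ?_⟩
    · exact hD.comp hR.continuousOn fun h hh => ⟨hh.1, hRe h hh.2⟩
    · simp only [hRi, hDi]
    · intro h hh he
      obtain ⟨h1, h2, h3⟩ := hDh (R h) hh (hRe h he)
      exact ⟨h1, fun x hx => h2 ⟨x, hCC' hx⟩ hx,
        fun x hx => h3 x fun hx' => hx (interior_subset hx')⟩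
  · intro H U hU C hC hCU
    obtain ⟨K, hK, hCK, hKU⟩ := exists_compact_between hC hU hCU
    obtain ⟨N, hN, D, hD, hDi, hDh⟩ := H U hU C K hC hK hCK hKU
    refine ⟨N, hN, D, hD, hDi, fun h hh he => ?_⟩
    obtain ⟨h1, h2, h3⟩ := hDh h hh he
    exact ⟨h1, h2, fun x hx => h3 x fun hx' => hx (hKU hx')⟩
end

section
/- Let X be a compact, locally connected metric space such that the Lipschitz deformation principle L(X) holds. Let U be open in X, let A and A′ be closed subsets of X with A′ a neighborhood of A, and let B be a compact subset of U. Then for every open Lipschitz embedding h : U → X sufficiently near the inclusion in the compact-open topology and satisfying h = inclusion on A′ ∩ U, there exists a Lipschitz isomorphism h′ : X → X such that h′ = h on B, and h′ = inclusion on X − U and on A. -/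
open Topology Metric Set

universe u v

theorem expansive_of_emb {X Y : Type*} [MetricSpace X] [MetricSpace Y] {f : X → Y}
    (hf : IsLipschitzEmbedding f) (x : X) :
    ∃ K : NNReal, ∃ t ∈ 𝓝 (f x), ∀ a b, f a ∈ t → f b ∈ t →
      edist a b ≤ K * edist (f a) (f b) := by
  obtain ⟨hi, hl, g, hg, hgl⟩ := hf
  obtain ⟨K, t, ht, hK⟩ := hgl (Set.rangeFactorization f x)
  rw [nhds_subtype_eq_comap, Filter.mem_comap] at ht
  obtain ⟨s, hs, hst⟩ := ht
  refine ⟨K, s, hs, fun a b ha hb => ?_⟩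
  have h1 := hK (x := Set.rangeFactorization f a) (hst ha)
    (y := Set.rangeFactorization f b) (hst hb)
  rwa [hg a, hg b] at h1

theorem emb_of_expansive {X Y : Type*} [MetricSpace X] [MetricSpace Y] {f : X → Y}
    (hi : Function.Injective f) (hl : LocallyLipschitz f)
    (h : ∀ x, ∃ K : NNReal, ∃ t ∈ 𝓝 (f x), ∀ a b, f a ∈ t → f b ∈ t →
      edist a b ≤ K * edist (f a) (f b)) : IsLipschitzEmbedding f := by
  refine ⟨hi, hl, fun y => y.2.choose, fun x => hi ?_, ?_⟩
  · exact (Set.rangeFactorization f x).2.choose_spec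
  · rintro ⟨_, x, rfl⟩
    obtain ⟨K, t, ht, hK⟩ := h x
    refine ⟨K, Subtype.val ⁻¹' t, ?_, ?_⟩
    · exact continuous_subtype_val.continuousAt.preimage_mem_nhds ht
    · intro y hy z hz
      have := hK y.2.choose z.2.choose (by rw [y.2.choose_spec]; exact hy)
        (by rw [z.2.choose_spec]; exact hz)
      rwa [y.2.choose_spec, z.2.choose_spec] at this

theorem isOpenEmbedding_of_ole {X Y : Type*} [MetricSpace X] [MetricSpace Y] {f : X → Y}
    (hf : IsOpenLipschitzEmbedding f) : IsOpenEmbedding f := by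
  obtain ⟨⟨hi, hl, g, hg, hgl⟩, ho⟩ := hf
  have hr : Function.RightInverse g (Set.rangeFactorization f) :=
    hg.rightInverse_of_surjective Set.rangeFactorization_surjective
  let e : X ≃ₜ Set.range f :=
    { toFun := Set.rangeFactorization f
      invFun := g
      left_inv := hg
      right_inv := hr
      continuous_toFun := hl.continuous.subtype_mk _
      continuous_invFun := hgl.continuous }
  exact ho.isOpenEmbedding_subtypeVal.comp e.isOpenEmbedding

theorem iso_iff {X : Type*} [MetricSpace X] {f : X → X} :
    IsLipschitzIso f ↔ ∃ g : X → X, Function.LeftInverse g f ∧ Function.RightInverse g f ∧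
      LocallyLipschitz f ∧ LocallyLipschitz g := by
  constructor
  · rintro ⟨⟨hi, hl, g, hg, hgl⟩, hs⟩
    have key : Function.LeftInverse (fun x => g ⟨x, hs x⟩) f := fun x => hg x
    refine ⟨fun x => g ⟨x, hs x⟩, key, key.rightInverse_of_surjective hs, hl, ?_⟩
    have : LocallyLipschitz (fun x : X => (⟨x, hs x⟩ : Set.range f)) := by
      apply LipschitzWith.locallyLipschitz (K := 1)
      intro a b
      simp [Subtype.edist_eq]
    exact hgl.comp this
  · rintro ⟨g, h1, h2, h3, h4⟩
    refine ⟨⟨h1.injective, h3, fun y => g y, fun x => h1 x, ?_⟩, h2.surjective⟩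
    exact h4.comp (LipschitzWith.subtype_val _).locallyLipschitz

theorem ole_restrict {X : Type*} [MetricSpace X] {U V : Set X} (hV : IsOpen V) (hVU : V ⊆ U)
    {h : U → X} (hh : IsOpenLipschitzEmbedding h) :
    IsOpenLipschitzEmbedding (h ∘ Set.inclusion hVU) := by
  have hl : LipschitzWith 1 (Set.inclusion hVU) := fun a b => by
    simp [Subtype.edist_eq]
  refine ⟨emb_of_expansive (hh.1.1.comp (Set.inclusion_injective hVU))
    (hh.1.2.1.comp hl.locallyLipschitz) fun x => ?_, ?_⟩
  · obtain ⟨K, t, ht, hK⟩ := expansive_of_emb hh.1 (Set.inclusion hVU x)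
    exact ⟨K, t, ht, fun a b ha hb => hK (Set.inclusion hVU a) (Set.inclusion hVU b) ha hb⟩
  · rw [Set.range_comp, Set.range_inclusion]
    exact (isOpenEmbedding_of_ole hh).isOpenMap _ (hV.preimage continuous_subtype_val)

theorem ole_incl {X : Type*} [MetricSpace X] {U : Set X} (hU : IsOpen U) :
    IsOpenLipschitzEmbedding (⇑(inclCM U) : U → X) := by
  refine ⟨emb_of_expansive Subtype.val_injective (LipschitzWith.subtype_val U).locallyLipschitz
    fun x => ⟨1, Set.univ, Filter.univ_mem, fun a b _ _ => ?_⟩, ?_⟩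
  · simp [inclCM, Subtype.edist_eq]
  · simpa [inclCM] using hU

theorem exists_eps {X : Type*} [MetricSpace X] {W : Set X} {N : Set C(W, X)}
    (hN : N ∈ 𝓝 (inclCM W)) : ∃ ε > 0, ∀ f : C(W, X), (∀ x : W, dist (f x) x < ε) → f ∈ N := by
  obtain ⟨⟨K, ε⟩, ⟨hK, hε⟩, h⟩ :=
    (nhds_basis_uniformity'
      (Metric.uniformity_basis_dist (α := X)).compactConvergenceUniformity).mem_iff.1 hN
  refine ⟨ε, hε, fun f hf => h ?_⟩
  intro x hx
  have := hf x
  rw [dist_comm] at this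
  exact this

/-- Gluing of an isomorphism on `P` with the identity on `Q`. -/
theorem ole_glue {X : Type*} [MetricSpace X] {P Q : Set X} (hP : IsOpen P) (hQ : IsOpen Q)
    {g : X → X} (hg : IsLipschitzIso g) (f : ↥(P ∪ Q) → X)
    (hfP : ∀ x : ↥(P ∪ Q), (x : X) ∈ P → f x = g x)
    (hfQ : ∀ x : ↥(P ∪ Q), (x : X) ∈ Q → f x = x)
    (hPQ : ∀ x ∈ P, g x ∈ Q → g x = x) :
    IsOpenLipschitzEmbedding f := by
  have hgo : IsOpenEmbedding g :=
    isOpenEmbedding_of_ole ⟨hg.1, by rw [hg.2.range_eq]; exact isOpen_univ⟩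
  have hi : Function.Injective f := by
    intro a b hab
    apply Subtype.ext
    rcases a.2 with ha | ha <;> rcases b.2 with hb | hb
    · rw [hfP a ha, hfP b hb] at hab
      exact hg.1.1 hab
    · rw [hfP a ha, hfQ b hb] at hab
      rw [← hab, hPQ a ha (hab ▸ hb)]
    · rw [hfQ a ha, hfP b hb] at hab
      rw [hab, hPQ b hb (hab ▸ ha)]
    · rwa [hfQ a ha, hfQ b hb] at hab
  have hval : Continuous (Subtype.val : ↥(P ∪ Q) → X) := continuous_subtype_val
  refine ⟨emb_of_expansive hi ?_ ?_, ?_⟩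
  · intro x
    rcases x.2 with hx | hx
    · obtain ⟨K, t, ht, hK⟩ := hg.1.2.1 x
      refine ⟨K, Subtype.val ⁻¹' (t ∩ P), hval.continuousAt.preimage_mem_nhds
        (Filter.inter_mem ht (hP.mem_nhds hx)), ?_⟩
      intro a ha b hb
      rw [hfP a ha.2, hfP b hb.2]
      exact hK ha.1 hb.1
    · refine ⟨1, Subtype.val ⁻¹' Q, hval.continuousAt.preimage_mem_nhds (hQ.mem_nhds hx), ?_⟩
      intro a ha b hb
      rw [hfQ a ha, hfQ b hb]
      simp [Subtype.edist_eq]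
  · intro x
    rcases x.2 with hx | hx
    · obtain ⟨K, t, ht, hK⟩ := expansive_of_emb hg.1 (x : X)
      have key : ∀ a, f a ∈ g '' P → (a : X) ∈ P := by
        rintro a ⟨p, hp, hpa⟩
        have : (⟨p, Or.inl hp⟩ : ↥(P ∪ Q)) = a := hi (by rw [hfP _ hp, hpa])
        rw [← this]; exact hp
      refine ⟨K, t ∩ g '' P, ?_, ?_⟩
      · rw [hfP x hx]
        exact Filter.inter_mem ht ((hgo.isOpenMap _ hP).mem_nhds ⟨x, hx, rfl⟩)
      · intro a b ha hb
        have ha' := hfP a (key a ha.2)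
        have hb' := hfP b (key b hb.2)
        rw [ha', hb']
        exact hK a b (ha' ▸ ha.1) (hb' ▸ hb.1)
    · have key : ∀ a, f a ∈ Q → f a = a := by
        intro a ha
        have : (⟨f a, Or.inr ha⟩ : ↥(P ∪ Q)) = a := hi (by rw [hfQ _ ha])
        exact congrArg Subtype.val this
      refine ⟨1, Q, ?_, ?_⟩
      · rw [hfQ x hx]; exact hQ.mem_nhds hx
      · intro a b ha hb
        rw [key a ha, key b hb]
        simp [Subtype.edist_eq]
  · have : Set.range f = g '' P ∪ Q := by
      ext y
      constructor
      · rintro ⟨a, rfl⟩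
        rcases a.2 with ha | ha
        · left; exact ⟨a, ha, (hfP a ha).symm⟩
        · right; rw [hfQ a ha]; exact ha
      · rintro (⟨p, hp, rfl⟩ | hy)
        · exact ⟨⟨p, Or.inl hp⟩, hfP _ hp⟩
        · exact ⟨⟨y, Or.inr hy⟩, hfQ _ hy⟩
    rw [this]
    exact (hgo.isOpenMap _ hP).union hQ

/-- Proposition 3.1 (relative deformation): let `X` be a compact, locally connected metric
space satisfying `L(X)`, `U` open, `A, A'` closed with `A'` a neighbourhood of `A`, and `B` a
compactum in `U`.  Every open Lipschitz embedding `h : U → X` sufficiently near the inclusion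
which is the inclusion on `A' ∩ U` extends to a Lipschitz isomorphism `h' : X → X` with
`h' = h` on `B` and `h' = i` on `X − U` and on `A`. -/
theorem relative_deformation
    {X : Type v} [MetricSpace X] [CompactSpace X] [LocallyConnectedSpace X]
    (hL : LipschitzDeformationPrinciple X)
    (U : Set X) (hU : IsOpen U)
    (A A' : Set X) (hA : IsClosed A) (hA' : IsClosed A') (hAA' : A ⊆ interior A')
    (B : Set X) (hB : IsCompact B) (hBU : B ⊆ U) :
    ∃ N ∈ 𝓝 (inclCM U), ∀ h : C(↥U, X), h ∈ N →
      IsOpenLipschitzEmbedding (⇑h : ↥U → X) →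
      (∀ x : ↥U, (x : X) ∈ A' → h x = (x : X)) →
      ∃ h' : X → X, IsLipschitzIso h' ∧
        (∀ x (hx : x ∈ B), h' x = h ⟨x, hBU hx⟩) ∧
        (∀ x ∉ U, h' x = x) ∧
        (∀ x ∈ A, h' x = x) := by
  classical
  -- the sets
  obtain ⟨U2, hU2o, hBU2, hU2U⟩ := normal_exists_closure_subset hB.isClosed hU hBU
  obtain ⟨B1, hB1o, hBB1, hB1U2⟩ := normal_exists_closure_subset hB.isClosed hU2o hBU2
  obtain ⟨N2, hN2, D2, hD2c, hD2i, hD2⟩ := hL U2 hU2o (closure B1) isClosed_closure.isCompact hB1U2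
  obtain ⟨δ, hδ, hδA⟩ := hA.isCompact.exists_thickening_subset_open isOpen_interior hAA'
  obtain ⟨η, hη, hηB⟩ := hB.exists_cthickening_subset_open hB1o hBB1
  set P : Set X := thickening (δ / 2) A with hPdef
  set Q : Set X := B1 ∪ (closure U2)ᶜ with hQdef
  have hPo : IsOpen P := isOpen_thickening
  have hQo : IsOpen Q := hB1o.union isClosed_closure.isOpen_compl
  have hAP : A ⊆ P := self_subset_thickening (by positivity) A
  have hUQ : Uᶜ ⊆ Q := fun x hx => Or.inr fun h => hx (hU2U h)
  have hCW : A ∪ (cthickening η B ∪ Uᶜ) ⊆ P ∪ Q :=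
    Set.union_subset_union hAP (Set.union_subset (hηB.trans Set.subset_union_left) hUQ)
  have hCc : IsCompact (A ∪ (cthickening η B ∪ Uᶜ)) :=
    (hA.union (isClosed_cthickening.union hU.isClosed_compl)).isCompact
  obtain ⟨N3, hN3, D3, -, -, hD3⟩ := hL (P ∪ Q) (hPo.union hQo) _ hCc hCW
  obtain ⟨ε, hε, hεN⟩ := exists_eps hN3
  set r := min ε (min η (δ / 2)) with hr
  have hr0 : 0 < r := by positivity
  have hU2sub : U2 ⊆ U := subset_closure.trans hU2U
  let res : C(↥U, X) → C(↥U2, X) := fun h => h.comp ⟨Set.inclusion hU2sub, continuous_inclusion hU2sub⟩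
  have hres : Continuous res := ContinuousMap.continuous_precomp _
  have hresi : res (inclCM U) = inclCM U2 := rfl
  have hM : {h : C(↥U2, X) | h ∈ N2 ∧ (h ∈ N2 ∧ IsOpenLipschitzEmbedding (⇑h : ↥U2 → X) →
      dist (D2 h) (ContinuousMap.id X) < r)} ∈ 𝓝 (inclCM U2) := by
    have h1 := hD2c (inclCM U2) ⟨mem_of_mem_nhds hN2, ole_incl hU2o⟩
    have h2 := h1 (Metric.ball_mem_nhds _ hr0)
    have h3 := mem_nhdsWithin_iff_eventually.1 h2
    filter_upwards [hN2, h3] with h hh1 hh2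
    refine ⟨hh1, fun hh => ?_⟩
    have := hh2 hh
    rw [Set.mem_preimage, hD2i] at this
    exact this
  refine ⟨res ⁻¹' _, hres.continuousAt.preimage_mem_nhds (hresi ▸ hM), ?_⟩
  rintro h ⟨hhN, hhd⟩ hole hhA
  have hole2 : IsOpenLipschitzEmbedding (⇑(res h) : ↥U2 → X) := ole_restrict hU2o hU2sub hole
  have hdist := hhd ⟨hhN, hole2⟩
  obtain ⟨hgiso, hgB, hgU⟩ := hD2 _ hhN hole2
  set g := D2 (res h) with hgdef
  have hgd : ∀ x, dist (g x) x < r := fun x =>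
    lt_of_le_of_lt (ContinuousMap.dist_apply_le_dist (g := ContinuousMap.id X) x) hdist
  have hgB1 : ∀ x (hx : x ∈ closure B1), g x = h ⟨x, hU2sub (hB1U2 hx)⟩ := fun x hx =>
    hgB ⟨x, hB1U2 hx⟩ hx
  -- on `A' ∩ Q` the map `g` is the identity
  have hgQ : ∀ x ∈ A', x ∈ Q → g x = x := by
    rintro x hxA (hx | hx)
    · rw [hgB1 x (subset_closure hx)]
      exact hhA _ hxA
    · exact hgU x fun h => hx (subset_closure h)
  have hPA' : P ⊆ A' := (thickening_mono (by linarith) A).trans (hδA.trans interior_subset)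
  let f0 : ↥(P ∪ Q) → X := fun x => if (x : X) ∈ P then g x else x
  have hfP : ∀ x : ↥(P ∪ Q), (x : X) ∈ P → f0 x = g x := fun x hx => if_pos hx
  have hfQ : ∀ x : ↥(P ∪ Q), (x : X) ∈ Q → f0 x = x := by
    intro x hx
    by_cases hxP : (x : X) ∈ P
    · rw [hfP x hxP, hgQ x (hPA' hxP) hx]
    · exact if_neg hxP
  have hPQ : ∀ x ∈ P, g x ∈ Q → g x = x := by
    intro x hx hgx
    obtain ⟨a, ha, hxa⟩ := mem_thickening_iff.1 hx
    have h1 : g x ∈ thickening δ A := by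
      refine mem_thickening_iff.2 ⟨a, ha, ?_⟩
      have h2 := dist_triangle (g x) x a
      have h3 := hgd x
      have h4 : r ≤ δ / 2 := (min_le_right _ _).trans (min_le_right _ _)
      linarith
    exact hgiso.1.1 (hgQ _ (interior_subset (hδA h1)) hgx)
  have hf0 := ole_glue hPo hQo hgiso f0 hfP hfQ hPQ
  let f : C(↥(P ∪ Q), X) := ⟨f0, hf0.1.2.1.continuous⟩
  have hfN : f ∈ N3 := by
    apply hεN
    intro x
    change dist (f0 x) x < ε
    by_cases hxP : (x : X) ∈ P
    · rw [hfP x hxP]; exact (hgd x).trans_le (min_le_left _ _)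
    · have : f0 x = x := if_neg hxP
      rw [this, dist_self]; exact hε
  obtain ⟨hkiso, hkC, -⟩ := hD3 f hfN hf0
  have hkA : ∀ x ∈ A, D3 f x = g x := fun x hx =>
    (hkC ⟨x, hCW (Or.inl hx)⟩ (Or.inl hx)).trans (hfP _ (hAP hx))
  have hkB : ∀ x ∈ cthickening η B, D3 f x = x := fun x hx =>
    (hkC ⟨x, hCW (Or.inr (Or.inl hx))⟩ (Or.inr (Or.inl hx))).trans (hfQ _ (Or.inl (hηB hx)))
  have hkU : ∀ x ∉ U, D3 f x = x := fun x hx =>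
    (hkC ⟨x, hCW (Or.inr (Or.inr hx))⟩ (Or.inr (Or.inr hx))).trans (hfQ _ (hUQ hx))
  obtain ⟨k', hk1, hk2, hk3, hk4⟩ := iso_iff.1 hkiso
  obtain ⟨g', hg1, hg2, hg3, hg4⟩ := iso_iff.1 hgiso
  refine ⟨k' ∘ g, iso_iff.2 ⟨g' ∘ D3 f, ?_, ?_, hk4.comp hg3, hg4.comp hk3⟩, ?_, ?_, ?_⟩
  · intro x
    simp only [Function.comp_apply]
    rw [hk2, hg1]
  · intro x
    simp only [Function.comp_apply]
    rw [hg2, hk1]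
  · intro x hx
    have h1 : g x ∈ cthickening η B := by
      refine thickening_subset_cthickening η B (mem_thickening_iff.2 ⟨x, hx, ?_⟩)
      exact (hgd x).trans_le ((min_le_right _ _).trans (min_le_left _ _))
    have h2 : k' (g x) = g x := by
      conv_lhs => rw [← hkB _ h1]
      exact hk1 _
    rw [Function.comp_apply, h2]
    exact hgB1 x (subset_closure (hBB1 hx))
  · intro x hx
    have h1 : g x = x := hgU x fun h => hx (hU2sub h)
    rw [Function.comp_apply, h1]
    conv_lhs => rw [← hkU x hx]
    exact hk1 _
  · intro x hx
    rw [Function.comp_apply, ← hkA x hx]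
    exact hk1 _
end
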